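/- arXiv:1901.06720 — 9 statements merged into one kernel-verified Lean document; each statement's English description precedes it below -/
import Mathlib

section
/- For every bicolored poset (P,C) there exists a polynomial p ∈ ℚ[X,Y] such that for all integers x and y with x ≥ 1 and 0 ≤ y ≤ x, the number Ω°_{P,C}(x,y) of strictly order preserving (x,y)-maps equals p(x,y). -/
open Finset

/-- A counting function split along the fibres of a map to a finite type. -/
theorem natCard_subtype_eq_sum_fiber {X ι : Type*} [Fintype ι] (Q : X → Prop) (g : X → ι)
    [Finite {x // Q x}] :
    Nat.card {x // Q x} = ∑ i, Nat.card {x // Q x ∧ g x = i} := by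
  have e : {x // Q x} ≃ Σ i, {x // Q x ∧ g x = i} :=
    { toFun := fun x => ⟨g x.1, x.1, x.2, rfl⟩
      invFun := fun s => ⟨s.2.1, s.2.2.1⟩
      left_inv := fun _ => rfl
      right_inv := by rintro ⟨i, x, hx, rfl⟩; rfl }
  have (i : ι) : Finite {x // Q x ∧ g x = i} :=
    Finite.of_injective (fun x => (⟨x.1, x.2.1⟩ : {x // Q x}))
      (fun a b h => Subtype.ext (congrArg (fun z => z.1) h))
  rw [Nat.card_congr e, Nat.card_sigma]

/-- Maps that are strictly monotone along `r` with image `S` correspond to surjective such maps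
onto the chain with `#S` elements. -/
theorem natCard_image_eq {α L : Type*} [Fintype α] [LinearOrder L] (r : α → α → Prop)
    (S : Finset L) :
    Nat.card {f : α → L // (∀ a b, r a b → f a < f b) ∧ univ.image f = S} =
      Nat.card {g : α → Fin #S // (∀ a b, r a b → g a < g b) ∧ Function.Surjective g} := by
  let o := S.orderIsoOfFin rfl
  have hmem {f : α → L} (h : univ.image f = S) (a : α) : f a ∈ S :=
    h ▸ mem_image_of_mem f (mem_univ a)
  refine Nat.card_congr
    { toFun := fun f => ⟨fun a => o.symm ⟨f.1 a, hmem f.2.2 a⟩, ?_, ?_⟩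
      invFun := fun g => ⟨fun a => o (g.1 a), ?_, ?_⟩
      left_inv := ?_
      right_inv := ?_ }
  · intro a b hab
    exact o.symm.lt_iff_lt.2 (f.2.1 a b hab)
  · intro i
    have hi : (o i : L) ∈ univ.image f.1 := by rw [f.2.2]; exact (o i).2
    obtain ⟨a, -, ha⟩ := mem_image.1 hi
    refine ⟨a, ?_⟩
    rw [OrderIso.symm_apply_eq]
    exact Subtype.ext ha
  · intro a b hab
    exact o.lt_iff_lt.2 (g.2.1 a b hab)
  · ext s
    simp only [mem_image, mem_univ, true_and]
    constructor
    · rintro ⟨a, rfl⟩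
      exact (o (g.1 a)).2
    · intro hs
      obtain ⟨a, ha⟩ := g.2.2 (o.symm ⟨s, hs⟩)
      exact ⟨a, by simp [ha]⟩
  · intro f
    ext a
    simp
  · intro g
    ext a
    simp

theorem exists_polynomial_eval_eq_choose (k : ℕ) :
    ∃ p : Polynomial ℚ, ∀ n : ℕ, p.eval (n : ℚ) = n.choose k := by
  refine ⟨Polynomial.C ((k.factorial : ℚ)⁻¹) * descPochhammer ℚ k, fun n => ?_⟩
  rw [Polynomial.eval_mul, Polynomial.eval_C, descPochhammer_eval_eq_descFactorial,
    Nat.descFactorial_eq_factorial_mul_choose, Nat.cast_mul]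
  field_simp

/-- The number of maps to a finite chain that are strictly monotone along a relation is a
polynomial in the length of the chain. -/
theorem exists_polynomial_natCard_strict {α : Type*} [Fintype α] (r : α → α → Prop) :
    ∃ p : Polynomial ℚ, ∀ (L : Type) [LinearOrder L] [Fintype L],
      (Nat.card {f : α → L // ∀ a b, r a b → f a < f b} : ℚ) =
        p.eval (Fintype.card L : ℚ) := by
  choose q hq using exists_polynomial_eval_eq_choose
  let e : ℕ → ℕ := fun k =>
    Nat.card {g : α → Fin k // (∀ a b, r a b → g a < g b) ∧ Function.Surjective g}
  have he (k : ℕ) (hk : Fintype.card α < k) : e k = 0 := by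
    have : IsEmpty {g : α → Fin k // (∀ a b, r a b → g a < g b) ∧ Function.Surjective g} :=
      ⟨fun g => absurd (Fintype.card_le_of_surjective g.1 g.2.2) (by simpa using hk)⟩
    exact Nat.card_of_isEmpty
  refine ⟨∑ k ∈ range (Fintype.card α + 1), q k * Polynomial.C (e k : ℚ), fun L _ _ => ?_⟩
  have h : Nat.card {f : α → L // ∀ a b, r a b → f a < f b} =
      ∑ k ∈ range (Fintype.card α + 1), (Fintype.card L).choose k * e k := by
    rw [natCard_subtype_eq_sum_fiber _ (fun f : α → L => univ.image f)]
    simp only [natCard_image_eq]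
    change ∑ S : Finset L, e #S = _
    rw [← powerset_univ, sum_powerset_apply_card, card_univ]
    simp only [smul_eq_mul]
    rcases le_total (Fintype.card L) (Fintype.card α) with hle | hle
    · refine sum_subset (range_mono (by omega)) fun k _ hk => ?_
      rw [Nat.choose_eq_zero_of_lt (by simpa using hk), zero_mul]
    · refine (sum_subset (range_mono (by omega)) fun k _ hk => ?_).symm
      rw [he k (by simpa using hk), mul_zero]
  rw [h, Polynomial.eval_finsetSum]
  push_cast
  exact sum_congr rfl fun k _ => by rw [Polynomial.eval_mul, hq, Polynomial.eval_C]

/-- Integer interval version of `exists_polynomial_natCard_strict`. -/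
theorem exists_polynomial_natCard_strict_Ioc {α : Type*} [Fintype α] (r : α → α → Prop) :
    ∃ p : Polynomial ℚ, ∀ u v : ℤ, u ≤ v →
      (Nat.card {f : α → ℤ // (∀ a, u < f a ∧ f a ≤ v) ∧ ∀ a b, r a b → f a < f b} : ℚ) =
        p.eval ((v : ℚ) - u) := by
  obtain ⟨p, hp⟩ := exists_polynomial_natCard_strict r
  refine ⟨p, fun u v huv => ?_⟩
  have hc : (Fintype.card (Set.Ioc u v) : ℚ) = (v : ℚ) - u := by
    rw [← Int.cast_sub, ← Int.card_fintype_Ioc_of_le u v huv, Int.cast_natCast]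
  rw [← hc, ← hp]
  refine congrArg Nat.cast (Nat.card_congr
    { toFun := fun f => ⟨fun a => ⟨f.1 a, f.2.1 a⟩, f.2.2⟩
      invFun := fun f => ⟨fun a => f.1 a, fun a => (f.1 a).2, f.2⟩
      left_inv := fun _ => rfl
      right_inv := fun _ => rfl })

/-- Strict maps whose set of elements of value at most `y` is a given down-set `I` are pairs of
strict maps on `I` and on its complement. -/
theorem natCard_strict_fiber {P : Type*} [Fintype P] [PartialOrder P] (C I : Finset P)
    (hC : ∀ c ∈ C, c ∉ I) (hI : ∀ a b : P, a < b → b ∈ I → a ∈ I) {x y : ℤ}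
    (hy : 0 ≤ y) (hyx : y ≤ x) :
    Nat.card {φ : P → ℤ // ((∀ a, 1 ≤ φ a ∧ φ a ≤ x) ∧ (∀ a b : P, a < b → φ a < φ b) ∧
        (∀ c ∈ C, y < φ c)) ∧ univ.filter (fun a => φ a ≤ y) = I} =
      Nat.card {f : {a // a ∈ I} → ℤ //
        (∀ a, 0 < f a ∧ f a ≤ y) ∧ ∀ a b, a < b → f a < f b} *
      Nat.card {f : {a // a ∉ I} → ℤ //
        (∀ a, y < f a ∧ f a ≤ x) ∧ ∀ a b, a < b → f a < f b} := by
  classical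
  rw [← Nat.card_prod]
  refine Nat.card_congr (((Equiv.piEquivPiSubtypeProd (· ∈ I) fun _ => ℤ).subtypeEquiv
    fun φ => ?_).trans Equiv.subtypeProdEquivProd)
  simp only [Equiv.piEquivPiSubtypeProd_apply, Finset.ext_iff, mem_filter, mem_univ, true_and,
    Subtype.forall, Subtype.mk_lt_mk]
  constructor
  · rintro ⟨⟨h1, h2, -⟩, h4⟩
    exact ⟨⟨fun a ha => ⟨(h1 a).1, (h4 a).2 ha⟩, fun a _ b _ hab => h2 a b hab⟩,
      fun a ha => ⟨not_le.1 fun h => ha ((h4 a).1 h), (h1 a).2⟩, fun a _ b _ hab => h2 a b hab⟩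
  · rintro ⟨⟨h1, h2⟩, h3, h4⟩
    refine ⟨⟨fun a => ?_, fun a b hab => ?_, fun c hc => (h3 c (hC c hc)).1⟩, fun a => ?_⟩
    · by_cases ha : a ∈ I
      · exact ⟨(h1 a ha).1, (h1 a ha).2.trans hyx⟩
      · have := h3 a ha
        omega
    · by_cases hb : b ∈ I
      · exact h2 a (hI a b hab hb) b hb hab
      · by_cases ha : a ∈ I
        · exact (h1 a ha).2.trans_lt (h3 b hb).1
        · exact h4 a ha b hb hab
    · refine ⟨fun h => ?_, fun ha => (h1 a ha).2⟩
      by_contra ha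
      exact absurd (h3 a ha).1 (not_lt.2 h)

theorem eval_aeval_eq {σ : Type*} (g : σ → ℚ) (q : MvPolynomial σ ℚ) (p : Polynomial ℚ) :
    MvPolynomial.eval g (Polynomial.aeval q p) = p.eval (MvPolynomial.eval g q) := by
  rw [← MvPolynomial.coe_aeval_eq_eval, RingHom.coe_coe, ← Polynomial.aeval_algHom_apply,
    Polynomial.coe_aeval_eq_eval]

/-- For every bicolored poset `(P, C)` there is a polynomial `p ∈ ℚ[X,Y]`
such that for all integers `x ≥ 1` and `0 ≤ y ≤ x`, the number `Ω°_{P,C}(x,y)` of strictly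
order preserving `(x,y)`-maps equals `p(x,y)`. -/
theorem stmt_0 (P : Type) [Fintype P] [PartialOrder P] (C : Finset P) :
    ∃ p : MvPolynomial (Fin 2) ℚ,
      ∀ x y : ℤ, 1 ≤ x → 0 ≤ y → y ≤ x →
        (Nat.card {φ : P → ℤ //
            (∀ a, 1 ≤ φ a ∧ φ a ≤ x) ∧
            (∀ a b : P, a < b → φ a < φ b) ∧
            (∀ c ∈ C, y < φ c)} : ℚ)
          = MvPolynomial.eval ![(x : ℚ), (y : ℚ)] p := by
  classical
  have key (I : Finset P) : ∃ p : MvPolynomial (Fin 2) ℚ, ∀ x y : ℤ, 0 ≤ y → y ≤ x →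
      (Nat.card {φ : P → ℤ // ((∀ a, 1 ≤ φ a ∧ φ a ≤ x) ∧ (∀ a b : P, a < b → φ a < φ b) ∧
        (∀ c ∈ C, y < φ c)) ∧ univ.filter (fun a => φ a ≤ y) = I} : ℚ)
          = MvPolynomial.eval ![(x : ℚ), (y : ℚ)] p := by
    by_cases h : (∀ c ∈ C, c ∉ I) ∧ ∀ a b : P, a < b → b ∈ I → a ∈ I
    · obtain ⟨p, hp⟩ := exists_polynomial_natCard_strict_Ioc
        (fun a b : {a // a ∈ I} => a < b)
      obtain ⟨q, hq⟩ := exists_polynomial_natCard_strict_Ioc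
        (fun a b : {a // a ∉ I} => a < b)
      refine ⟨Polynomial.aeval (MvPolynomial.X 1) p *
        Polynomial.aeval (MvPolynomial.X 0 - MvPolynomial.X 1) q, fun x y hy hyx => ?_⟩
      rw [natCard_strict_fiber C I h.1 h.2 hy hyx, Nat.cast_mul, hp 0 y hy, hq y x hyx,
        map_mul, eval_aeval_eq, eval_aeval_eq]
      simp
    · refine ⟨0, fun x y hy hyx => ?_⟩
      rw [map_zero, Nat.cast_eq_zero]
      refine @Nat.card_of_isEmpty _ ⟨?_⟩
      rintro ⟨φ, ⟨-, h2, h3⟩, rfl⟩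
      refine h ⟨fun c hc => ?_, fun a b hab hb => ?_⟩
      · simpa using h3 c hc
      · have := h2 a b hab
        simp only [mem_filter, mem_univ, true_and] at hb ⊢
        omega
  choose p hp using key
  refine ⟨∑ I, p I, fun x y _ hy hyx => ?_⟩
  have : Finite {φ : P → ℤ // (∀ a, 1 ≤ φ a ∧ φ a ≤ x) ∧
      (∀ a b : P, a < b → φ a < φ b) ∧ (∀ c ∈ C, y < φ c)} :=
    Finite.of_injective
      (fun φ a => (⟨φ.1 a, φ.2.1 a⟩ : Set.Icc 1 x))
      (fun φ ψ h => Subtype.ext (funext fun a => congrArg Subtype.val (congrFun h a)))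
  rw [natCard_subtype_eq_sum_fiber _ (fun φ : P → ℤ => univ.filter (fun a => φ a ≤ y)),
    map_sum, Nat.cast_sum]
  exact sum_congr rfl fun I _ => hp I x y hy hyx
end

section
/- Let (P,C) be a bicolored poset with n elements, and let p°, p ∈ ℚ[X,Y] be polynomials such that Ω°_{P,C}(x,y) = p°(x,y) and Ω_{P,C}(x,y) = p(x,y) for all integers x and y with x ≥ 1 and 0 ≤ y ≤ x. Then (−1)^n · p°(−X,−Y) = p(X, Y+1) as an identity of polynomials in ℚ[X,Y]. -/
namespace BicoloredPoset

open Finset Matrix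

section BinomialSeries

variable {R : Type*} [Ring R] [Algebra ℚ R]

/-- The truncated binomial series `∑ i < N, choose t i • η ^ i`, that is `(1 + η) ^ t` for
nilpotent `η`. -/
noncomputable def binomialSeries (N : ℕ) (η : R) (t : ℚ) : R :=
  ∑ i ∈ range N, Ring.choose t i • η ^ i

lemma binomialSeries_zero {N : ℕ} (hN : 0 < N) (η : R) : binomialSeries N η 0 = 1 := by
  obtain ⟨N, rfl⟩ := Nat.exists_eq_succ_of_ne_zero hN.ne'
  simp [binomialSeries, sum_range_succ', Ring.choose_zero_succ]

lemma binomialSeries_add_one {N : ℕ} {η : R} (hη : η ^ N = 0) (t : ℚ) :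
    binomialSeries N η (t + 1) = (1 + η) * binomialSeries N η t := by
  cases N with
  | zero => simp [binomialSeries]
  | succ N =>
    have h : η * binomialSeries (N + 1) η t = ∑ i ∈ range N, Ring.choose t i • η ^ (i + 1) := by
      rw [binomialSeries, mul_sum, sum_range_succ, mul_smul_comm, ← pow_succ', hη, smul_zero,
        add_zero]
      exact sum_congr rfl fun i _ => by rw [mul_smul_comm, pow_succ']
    rw [add_mul, one_mul, h]
    simp only [binomialSeries, sum_range_succ', Ring.choose_succ_succ, add_smul, sum_add_distrib,
      Ring.choose_zero_right]
    abel

lemma binomialSeries_natCast {N : ℕ} (hN : 0 < N) {η : R} (hη : η ^ N = 0) (k : ℕ) :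
    binomialSeries N η k = (1 + η) ^ k := by
  induction k with
  | zero => simp [binomialSeries_zero hN]
  | succ k ih => rw [Nat.cast_succ, binomialSeries_add_one hη, ih, pow_succ']

lemma pow_mul_binomialSeries_neg {N : ℕ} (hN : 0 < N) {η : R} (hη : η ^ N = 0) (k : ℕ) :
    (1 + η) ^ k * binomialSeries N η (-k) = 1 := by
  induction k with
  | zero => simp [binomialSeries_zero hN]
  | succ k ih =>
    rw [pow_succ, mul_assoc, ← binomialSeries_add_one hη]
    simpa using ih

lemma binomialSeries_neg_natCast {N : ℕ} (hN : 0 < N) {η μ : R} (hη : η ^ N = 0)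
    (hμ : μ * (1 + η) = 1) (k : ℕ) : binomialSeries N η (-k) = μ ^ k := by
  have h : ∀ k : ℕ, μ ^ k * (1 + η) ^ k = 1 := by
    intro k
    induction k with
    | zero => simp
    | succ k ih =>
      rw [pow_succ μ, pow_succ' (1 + η), mul_assoc, ← mul_assoc μ, hμ, one_mul, ih]
  exact (left_inv_eq_right_inv (h k) (pow_mul_binomialSeries_neg hN hη k)).symm

end BinomialSeries

lemma exists_polynomial_eval_eq_choose (i : ℕ) :
    ∃ c : Polynomial ℚ, ∀ t, c.eval t = Ring.choose t i := by
  refine ⟨Polynomial.C ((i.factorial : ℚ)⁻¹) *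
    (ascPochhammer ℚ i).comp (Polynomial.X - Polynomial.C (i : ℚ) + 1), fun t => ?_⟩
  rw [Ring.choose_eq_smul, Polynomial.descPochhammer_smeval_eq_ascPochhammer,
    Polynomial.ascPochhammer_smeval_eq_eval]
  simp

/-- Matrix entries of a product of two binomial series are polynomial in the exponents. -/
lemma exists_mvPolynomial_eval_eq_binomialSeries_mul {ι : Type*} [Fintype ι] [DecidableEq ι]
    (N : ℕ) (η θ : Matrix ι ι ℚ) (r s : ι) (p q : MvPolynomial (Fin 2) ℚ) :
    ∃ G : MvPolynomial (Fin 2) ℚ, ∀ v, MvPolynomial.eval v G =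
      (binomialSeries N η (MvPolynomial.eval v p) *
        binomialSeries N θ (MvPolynomial.eval v q)) r s := by
  choose c hc using exists_polynomial_eval_eq_choose
  refine ⟨∑ u, (∑ i ∈ range N, Polynomial.aeval p (c i) * MvPolynomial.C ((η ^ i) r u)) *
    (∑ i ∈ range N, Polynomial.aeval q (c i) * MvPolynomial.C ((θ ^ i) u s)), fun v => ?_⟩
  have key : ∀ (a : MvPolynomial (Fin 2) ℚ) i,
      MvPolynomial.eval v (Polynomial.aeval a (c i)) = Ring.choose (MvPolynomial.eval v a) i := by
    intro a i
    rw [← hc, ← MvPolynomial.coe_aeval_eq_eval, RingHom.coe_coe, ← Polynomial.aeval_algHom_apply,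
      Polynomial.coe_aeval_eq_eval]
  simp [Matrix.mul_apply, binomialSeries, Matrix.sum_apply, key]

lemma eval_aeval_pair (a b r : MvPolynomial (Fin 2) ℚ) (v : Fin 2 → ℚ) :
    MvPolynomial.eval v (MvPolynomial.aeval ![a, b] r) =
      MvPolynomial.eval ![MvPolynomial.eval v a, MvPolynomial.eval v b] r := by
  rw [← MvPolynomial.coe_aeval_eq_eval, RingHom.coe_coe, ← AlgHom.comp_apply,
    MvPolynomial.comp_aeval, ← MvPolynomial.coe_aeval_eq_eval, RingHom.coe_coe]
  congr 2
  ext i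
  fin_cases i <;> rfl

/-- A polynomial in two variables is determined by its values at the integer points of the cone
`1 ≤ y ≤ x`. -/
lemma mvPolynomial_ext_of_cone {p q : MvPolynomial (Fin 2) ℚ}
    (h : ∀ m k : ℕ, MvPolynomial.eval ![((m + k + 1 : ℕ) : ℚ), ((k + 1 : ℕ) : ℚ)] p =
      MvPolynomial.eval ![((m + k + 1 : ℕ) : ℚ), ((k + 1 : ℕ) : ℚ)] q) : p = q := by
  have key : MvPolynomial.aeval ![MvPolynomial.X 0 + MvPolynomial.X 1 + 1,
        (MvPolynomial.X 1 + 1 : MvPolynomial (Fin 2) ℚ)] p =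
      MvPolynomial.aeval ![MvPolynomial.X 0 + MvPolynomial.X 1 + 1, MvPolynomial.X 1 + 1] q := by
    refine MvPolynomial.funext_set (fun _ => Set.range ((↑) : ℕ → ℚ))
      (fun _ => Set.infinite_range_of_injective Nat.cast_injective) fun v hv => ?_
    obtain ⟨m, hm⟩ := hv 0 trivial
    obtain ⟨k, hk⟩ := hv 1 trivial
    rw [eval_aeval_pair, eval_aeval_pair]
    simpa [← hm, ← hk] using h m k
  refine MvPolynomial.funext fun v => ?_
  have := congrArg (MvPolynomial.eval ![v 0 - v 1, v 1 - 1]) key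
  have hv : ![v 0, v 1] = v := by
    ext i
    fin_cases i <;> rfl
  rw [eval_aeval_pair, eval_aeval_pair] at this
  simpa [hv] using this

section Steps

variable {P : Type*}

/-- `U` is obtained from `S` by removing elements outside `B` that may all take a new largest
value, where `ρ a b` requires `φ a + ε ≤ φ b`. -/
def IsStep (ρ : P → P → Prop) (ε : ℤ) (B U S : Finset P) : Prop :=
  U ⊆ S ∧ ∀ a ∈ S, a ∉ U → a ∉ B ∧ ∀ b ∈ S, ρ a b → b ∉ U ∧ ε ≤ 0

lemma isStep_self (ρ : P → P → Prop) (ε : ℤ) (B S : Finset P) : IsStep ρ ε B S S :=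
  ⟨Subset.rfl, fun _ ha haS => absurd ha haS⟩

open Classical in
/-- The matrix of `IsStep`. -/
noncomputable def stepMatrix (ρ : P → P → Prop) (ε : ℤ) (B : Finset P) :
    Matrix (Finset P) (Finset P) ℚ :=
  fun S U => if IsStep ρ ε B U S then 1 else 0

/-- Maps `S → {1, …, x}`, extended by `0`, with `φ a + ε ≤ φ b` whenever `ρ a b` and with values
at least `z` on `C`. -/
def IsPartialMap (ρ : P → P → Prop) (ε : ℤ) (C : Finset P) (x z : ℤ) (S : Finset P)
    (φ : P → ℤ) : Prop :=
  (∀ a ∈ S, 1 ≤ φ a ∧ φ a ≤ x) ∧ (∀ a, a ∉ S → φ a = 0) ∧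
    (∀ a ∈ S, ∀ b ∈ S, ρ a b → φ a + ε ≤ φ b) ∧ ∀ c ∈ C, c ∈ S → z ≤ φ c

open Classical in
/-- Maps with values in `{1, …, x + 1}` attaining values at most `x` exactly on `U` are maps
`U → {1, …, x}`, provided `U` is obtained by a step. -/
noncomputable def fiberEquiv (ρ : P → P → Prop) {ε : ℤ} (hε₀ : 0 ≤ ε) (hε₁ : ε ≤ 1)
    (C : Finset P) (x : ℕ) (z : ℤ) (S U : Finset P) :
    {φ : {φ : P → ℤ // IsPartialMap ρ ε C (x + 1) z S φ} //
        ({a ∈ S | φ.1 a ≤ x} : Finset P) = U} ≃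
      {ψ : P → ℤ // IsStep ρ ε (if x + 1 < z then C else ∅) U S ∧ IsPartialMap ρ ε C x z U ψ} where
  toFun φ := ⟨fun a => if a ∈ U then φ.1.1 a else 0, by
    obtain ⟨⟨φ, h₁, h₂, h₃, h₄⟩, rfl⟩ := φ
    have h₅ : ∀ a ∈ S, ¬ φ a ≤ x → φ a = x + 1 := fun a ha h => by
      have := h₁ a ha
      omega
    refine ⟨⟨filter_subset _ _, fun a ha haU => ?_⟩, ?_, ?_, ?_, ?_⟩
    · simp only [mem_filter, ha, true_and] at haU
      have h₆ := h₅ a ha haU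
      refine ⟨?_, fun b hb hab => ?_⟩
      · split_ifs with hz
        · intro haC
          have := h₄ a haC ha
          omega
        · simp
      · have h₇ := h₃ a ha b hb hab
        have h₈ := h₁ b hb
        simp only [mem_filter, hb, true_and]
        omega
    · intro a ha
      simp only [ha, if_true]
      simp only [mem_filter] at ha
      exact ⟨(h₁ a ha.1).1, ha.2⟩
    · intro a ha
      simp only [ha, if_false]
    · intro a ha b hb hab
      simp only [ha, hb, if_true]
      exact h₃ a (mem_filter.1 ha).1 b (mem_filter.1 hb).1 hab
    · intro c hc hcU
      simp only [hcU, if_true]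
      exact h₄ c hc (mem_filter.1 hcU).1⟩
  invFun ψ := ⟨⟨fun a => if a ∈ U then ψ.1 a else if a ∈ S then x + 1 else 0, by
    obtain ⟨ψ, ⟨hUS, hs⟩, h₁, h₂, h₃, h₄⟩ := ψ
    refine ⟨fun a ha => ?_, fun a ha => ?_, fun a ha b hb hab => ?_, fun c hc hcS => ?_⟩
    · by_cases haU : a ∈ U
      · have := h₁ a haU
        simp only [haU, if_true]
        omega
      · simp only [haU, ha, if_true, if_false]
        omega
    · have haU : a ∉ U := fun h => ha (hUS h)
      simp only [haU, ha, if_false]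
    · by_cases haU : a ∈ U <;> by_cases hbU : b ∈ U <;>
        simp only [haU, hbU, ha, hb, if_true, if_false]
      · exact h₃ a haU b hbU hab
      · have := h₁ a haU
        omega
      · exact absurd hbU ((hs a ha haU).2 b hb hab).1
      · have := ((hs a ha haU).2 b hb hab).2
        omega
    · by_cases hcU : c ∈ U <;> simp only [hcU, hcS, if_true, if_false]
      · exact h₄ c hc hcU
      · by_contra hlt
        have := (hs c hcS hcU).1
        rw [if_pos (by omega)] at this
        exact this hc⟩, by
    obtain ⟨ψ, ⟨hUS, hs⟩, h₁, h₂, h₃, h₄⟩ := ψ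
    ext a
    by_cases haU : a ∈ U
    · simp [haU, hUS haU, (h₁ a haU).2]
    · by_cases ha : a ∈ S <;> simp [haU, ha]⟩
  left_inv φ := by
    obtain ⟨⟨φ, h₁, h₂, h₃, h₄⟩, rfl⟩ := φ
    apply Subtype.ext
    apply Subtype.ext
    ext a
    by_cases ha : a ∈ S
    · by_cases hx : φ a ≤ x
      · simp [ha, hx]
      · have := h₁ a ha
        simp only [mem_filter, ha, hx, and_false, if_false, if_true]
        omega
    · simp [ha, h₂ a ha]
  right_inv ψ := by
    obtain ⟨ψ, hs, h₁, h₂, h₃, h₄⟩ := ψ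
    apply Subtype.ext
    ext a
    by_cases haU : a ∈ U
    · simp [haU]
    · simp [haU, h₂ a haU]

/-- The vector counting maps on all subsets of `P`. -/
noncomputable def mapCount (ρ : P → P → Prop) (ε : ℤ) (C : Finset P) (x z : ℤ) :
    Finset P → ℚ :=
  fun S => Nat.card {φ : P → ℤ // IsPartialMap ρ ε C x z S φ}

open Classical in
lemma mapCount_zero (ρ : P → P → Prop) (ε : ℤ) (C : Finset P) (z : ℤ) :
    mapCount ρ ε C 0 z = Pi.single ∅ 1 := by
  ext S
  rcases S.eq_empty_or_nonempty with rfl | ⟨a, ha⟩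
  · have : Unique {φ : P → ℤ // IsPartialMap ρ ε C 0 z ∅ φ} :=
      { default := ⟨0, by simp [IsPartialMap]⟩
        uniq := fun φ => Subtype.ext (funext fun a => φ.2.2.1 a (notMem_empty a)) }
    simp [mapCount]
  · have : IsEmpty {φ : P → ℤ // IsPartialMap ρ ε C 0 z S φ} :=
      ⟨fun φ => by have := φ.2.1 a ha; omega⟩
    simp [mapCount, ne_empty_of_mem ha]

variable [Fintype P]

open Classical in
lemma pow_apply_eq_zero_of_card_lt {A : Matrix (Finset P) (Finset P) ℚ}
    (hA : ∀ S U, A S U ≠ 0 → #U < #S) (k : ℕ) {S U : Finset P} (h : (A ^ k) S U ≠ 0) :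
    #U + k ≤ #S := by
  induction k generalizing S with
  | zero =>
    obtain rfl : S = U := by
      by_contra hne
      exact h (by simp [hne])
    simp
  | succ k ih =>
    rw [pow_succ', Matrix.mul_apply] at h
    obtain ⟨V, -, hV⟩ := exists_ne_zero_of_sum_ne_zero h
    have h₁ := hA S V (left_ne_zero_of_mul hV)
    have h₂ := ih (right_ne_zero_of_mul hV)
    omega

open Classical in
lemma pow_card_add_one_eq_zero {A : Matrix (Finset P) (Finset P) ℚ}
    (hA : ∀ S U, A S U ≠ 0 → #U < #S) : A ^ (Fintype.card P + 1) = 0 := by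
  ext S U
  by_contra h
  have h₁ := pow_apply_eq_zero_of_card_lt hA _ h
  have h₂ := card_le_univ S
  omega

lemma finite_isPartialMap (ρ : P → P → Prop) (ε : ℤ) (C : Finset P) (x z : ℤ) (S : Finset P) :
    Finite {φ : P → ℤ // IsPartialMap ρ ε C x z S φ} := by
  classical
  refine Set.Finite.subset (Set.finite_Icc (0 : P → ℤ) (fun _ => max x 0)) fun φ hφ => ?_
  constructor <;> intro a <;> by_cases ha : a ∈ S
  · have := hφ.1 a ha
    simp only [Pi.zero_apply]
    omega
  · simp [hφ.2.1 a ha]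
  · have := hφ.1 a ha
    exact le_max_of_le_left this.2
  · simp [hφ.2.1 a ha]

open Classical in
lemma mapCount_add_one (ρ : P → P → Prop) {ε : ℤ} (hε₀ : 0 ≤ ε) (hε₁ : ε ≤ 1) (C : Finset P)
    (x : ℕ) (z : ℤ) :
    mapCount ρ ε C (x + 1) z =
      stepMatrix ρ ε (if x + 1 < z then C else ∅) *ᵥ mapCount ρ ε C x z := by
  ext S
  have := finite_isPartialMap ρ ε C (x + 1) z S
  simp only [mapCount, mulVec, dotProduct]
  rw [← Nat.card_congr (Equiv.sigmaFiberEquiv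
    fun φ : {φ : P → ℤ // IsPartialMap ρ ε C (x + 1) z S φ} => ({a ∈ S | φ.1 a ≤ x} : Finset P)),
    Nat.card_sigma, Nat.cast_sum]
  refine sum_congr rfl fun U _ => ?_
  rw [Nat.card_congr (fiberEquiv ρ hε₀ hε₁ C x z S U)]
  by_cases h : IsStep ρ ε (if x + 1 < z then C else ∅) U S <;> simp [stepMatrix, h]

open Classical in
lemma mapCount_of_lt (ρ : P → P → Prop) {ε : ℤ} (hε₀ : 0 ≤ ε) (hε₁ : ε ≤ 1) (C : Finset P)
    (z : ℤ) (k : ℕ) (hk : k < z) :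
    mapCount ρ ε C k z = (stepMatrix ρ ε C ^ k) *ᵥ Pi.single ∅ 1 := by
  induction k with
  | zero => rw [Nat.cast_zero, mapCount_zero, pow_zero, one_mulVec]
  | succ k ih =>
    push_cast at hk ⊢
    rw [mapCount_add_one ρ hε₀ hε₁, if_pos hk, ih (by omega), mulVec_mulVec, pow_succ']

open Classical in
lemma mapCount_add (ρ : P → P → Prop) {ε : ℤ} (hε₀ : 0 ≤ ε) (hε₁ : ε ≤ 1) (C : Finset P)
    (m k : ℕ) :
    mapCount ρ ε C (m + k : ℕ) (k + 1) =
      (stepMatrix ρ ε ∅ ^ m * stepMatrix ρ ε C ^ k) *ᵥ Pi.single ∅ 1 := by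
  induction m with
  | zero => simp [mapCount_of_lt ρ hε₀ hε₁]
  | succ m ih =>
    rw [show ((m + 1 + k : ℕ) : ℤ) = (m + k : ℕ) + 1 by push_cast; ring,
      mapCount_add_one ρ hε₀ hε₁, if_neg (by push_cast; omega), ih, mulVec_mulVec, ← mul_assoc,
      pow_succ']

open Classical in
/-- Counting maps on all of `P` as an entry of a product of powers of step matrices. -/
lemma card_maps_eq (ρ : P → P → Prop) {ε : ℤ} (hε₀ : 0 ≤ ε) (hε₁ : ε ≤ 1) (C : Finset P)
    (m k : ℕ) :
    (Nat.card {φ : P → ℤ // (∀ a, 1 ≤ φ a ∧ φ a ≤ (m + k : ℕ)) ∧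
        (∀ a b, ρ a b → φ a + ε ≤ φ b) ∧ ∀ c ∈ C, (k : ℤ) + 1 ≤ φ c} : ℚ) =
      (stepMatrix ρ ε ∅ ^ m * stepMatrix ρ ε C ^ k) univ ∅ := by
  have h := congrFun (mapCount_add ρ hε₀ hε₁ C m k) univ
  rw [mulVec_single_one] at h
  simpa [mapCount, IsPartialMap] using h

end Steps

section Inverse

variable {P : Type*} [Fintype P]

open Classical in
/-- The diagonal matrix of signs `(-1) ^ #S`. -/
noncomputable def signMatrix (P : Type*) [Fintype P] : Matrix (Finset P) (Finset P) ℚ :=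
  diagonal fun S => (-1) ^ #S

open Classical in
lemma signMatrix_mul_self : signMatrix P * signMatrix P = 1 := by
  simp [signMatrix, diagonal_mul_diagonal, ← pow_add, ← two_mul]

variable [PartialOrder P]

/-- The inverse of the weak step matrix. -/
noncomputable def signedStepMatrix (B : Finset P) : Matrix (Finset P) (Finset P) ℚ :=
  signMatrix P * stepMatrix (P := P) (· < ·) 1 B * signMatrix P

open Classical in
lemma signedStepMatrix_apply (B S U : Finset P) :
    signedStepMatrix B S U =
      if IsStep (· < ·) 1 B U S then (-1) ^ #S * (-1) ^ #U else 0 := by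
  simp [signedStepMatrix, signMatrix, stepMatrix]

open Classical in
lemma signedStepMatrix_mul_stepMatrix (B : Finset P) :
    signedStepMatrix B * stepMatrix (· ≤ ·) 0 B = 1 := by
  ext S V
  rw [Matrix.mul_apply]
  simp only [signedStepMatrix_apply, stepMatrix]
  by_cases hSV : S = V
  · subst hSV
    rw [sum_eq_single S]
    · simp [isStep_self, ← pow_add, ← two_mul]
    · intro U _ hU
      by_cases h₁ : U ⊆ S
      · have h₂ : ¬ S ⊆ U := fun h => hU (h₁.antisymm h)
        simp [IsStep, h₂]
      · simp [IsStep, h₁]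
    · simp
  · rw [one_apply_ne hSV]
    by_cases hall : ∃ U, IsStep (· < ·) 1 B U S ∧ IsStep (· ≤ ·) 0 B V U
    swap
    · refine sum_eq_zero fun U _ => ?_
      have := not_exists.1 hall U
      by_cases h₁ : IsStep (· < ·) 1 B U S
      · have h₂ : ¬ IsStep (· ≤ ·) 0 B V U := fun h => this ⟨h₁, h⟩
        simp [h₂]
      · simp [h₁]
    have hst : IsStep (· ≤ ·) 0 B V S := by
      obtain ⟨U, ⟨h₁, h₂⟩, h₃, h₄⟩ := hall
      refine ⟨h₃.trans h₁, fun a ha haV => ?_⟩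
      by_cases haU : a ∈ U
      · refine ⟨(h₄ a haU haV).1, fun b hb hab => ⟨fun hbV => ?_, le_rfl⟩⟩
        exact ((h₄ a haU haV).2 b (h₃ hbV) hab).1 hbV
      · refine ⟨(h₂ a ha haU).1, fun b hb hab => ⟨fun hbV => ?_, le_rfl⟩⟩
        rcases hab.eq_or_lt with rfl | hlt
        · exact haV hbV
        · have := ((h₂ a ha haU).2 b hb hlt).2
          omega
    obtain ⟨a, haS, haV⟩ : ∃ a ∈ S, a ∉ V := by
      by_contra! h
      exact hSV (Subset.antisymm h hst.1)
    obtain ⟨m, ham, hm⟩ := S.exists_le_maximal haS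
    have hmV : m ∉ V := ((hst.2 a haS haV).2 m hm.prop ham).1
    have hmmax : ∀ b ∈ S, ¬ m < b := fun b hb hlt => hm.not_gt hb hlt
    have hterm : ∀ U, (IsStep (· < ·) 1 B U S ∧ IsStep (· ≤ ·) 0 B V U) ↔
        V ⊆ U ∧ U ⊆ S ∧ ∀ c ∈ S, c ∉ U → ∀ b ∈ S, ¬ c < b := by
      intro U
      constructor
      · rintro ⟨h₁, h₂⟩
        refine ⟨h₂.1, h₁.1, fun c hc hcU b hb hlt => ?_⟩
        have := ((h₁.2 c hc hcU).2 b hb hlt).2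
        omega
      · rintro ⟨h₁, h₂, h₃⟩
        refine ⟨⟨h₂, fun c hc hcU => ⟨(hst.2 c hc fun h => hcU (h₁ h)).1, fun b hb hlt =>
          absurd hlt (h₃ c hc hcU b hb)⟩⟩, h₁, fun c hc hcV => ⟨(hst.2 c (h₂ hc) hcV).1,
          fun b hb hcb => ((hst.2 c (h₂ hc) hcV).2 b (h₂ hb) hcb)⟩⟩
    have hrw : ∀ U, ((if IsStep (· < ·) 1 B U S then (-1 : ℚ) ^ #S * (-1) ^ #U else 0) *
        if IsStep (· ≤ ·) 0 B V U then 1 else 0) =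
        if V ⊆ U ∧ U ⊆ S ∧ ∀ c ∈ S, c ∉ U → ∀ b ∈ S, ¬ c < b then
          (-1 : ℚ) ^ #S * (-1) ^ #U else 0 := by
      intro U
      simp only [← hterm U, ite_and]
      split_ifs <;> simp
    simp only [hrw]
    have hins : ∀ U, m ∉ U → ((V ⊆ insert m U ∧ insert m U ⊆ S ∧
        ∀ c ∈ S, c ∉ insert m U → ∀ b ∈ S, ¬ c < b) ↔
        (V ⊆ U ∧ U ⊆ S ∧ ∀ c ∈ S, c ∉ U → ∀ b ∈ S, ¬ c < b)) := by
      intro U hmU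
      rw [subset_insert_iff_of_notMem hmV, insert_subset_iff]
      refine and_congr_right fun _ => ⟨fun h => ⟨h.1.2, fun c hc hcU => ?_⟩,
        fun h => ⟨⟨hm.prop, h.1⟩, fun c hc hcU => h.2 c hc fun h' => hcU (mem_insert_of_mem h')⟩⟩
      by_cases hcm : c = m
      · exact hcm ▸ hmmax
      · exact h.2 c hc (by simp [hcm, hcU])
    refine sum_involution (fun U _ => if m ∈ U then U.erase m else insert m U) ?_ ?_ ?_ ?_
    · intro U _
      by_cases hmU : m ∈ U
      · obtain ⟨W, hW, rfl⟩ : ∃ W, m ∉ W ∧ insert m W = U :=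
          ⟨U.erase m, notMem_erase _ _, insert_erase hmU⟩
        simp only [mem_insert_self, if_true, erase_insert hW, hins W hW, card_insert_of_notMem hW]
        split_ifs <;> ring
      · simp only [hmU, if_false, hins U hmU, card_insert_of_notMem hmU]
        split_ifs <;> ring
    · intro U _ _
      by_cases hmU : m ∈ U
      · simp [hmU]
      · simp [hmU]
    · simp
    · intro U _
      by_cases hmU : m ∈ U
      · simp [hmU]
      · simp [hmU]

open Classical in
lemma stepMatrix_sub_one_pow (B : Finset P) :
    (stepMatrix (P := P) (· ≤ ·) 0 B - 1) ^ (Fintype.card P + 1) = 0 := by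
  refine pow_card_add_one_eq_zero fun S U h => ?_
  by_cases hSU : S = U
  · subst hSU
    simp [stepMatrix, isStep_self] at h
  · have hs : IsStep (· ≤ ·) 0 B U S := by
      by_contra hs
      simp [stepMatrix, hs, hSU] at h
    exact card_lt_card (hs.1.ssubset_of_ne (Ne.symm hSU))

open Classical in
lemma stepMatrix_lt_pow_mul_pow_apply (C : Finset P) (m k : ℕ) :
    (stepMatrix (P := P) (· < ·) 1 ∅ ^ m * stepMatrix (P := P) (· < ·) 1 C ^ k) univ ∅ =
      (-1) ^ Fintype.card P *
        (signedStepMatrix (P := P) ∅ ^ m * signedStepMatrix C ^ k) univ ∅ := by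
  have hpow : ∀ (B : Finset P) (k : ℕ), signedStepMatrix B ^ k =
      signMatrix P * stepMatrix (P := P) (· < ·) 1 B ^ k * signMatrix P := by
    intro B k
    induction k with
    | zero => simp [signMatrix_mul_self]
    | succ k ih =>
      rw [pow_succ, ih, signedStepMatrix, pow_succ]
      simp only [mul_assoc]
      rw [← mul_assoc (signMatrix P) (signMatrix P), signMatrix_mul_self, one_mul]
  have hprod : signedStepMatrix (P := P) ∅ ^ m * signedStepMatrix C ^ k = signMatrix P *
      (stepMatrix (P := P) (· < ·) 1 ∅ ^ m * stepMatrix (P := P) (· < ·) 1 C ^ k) *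
        signMatrix P := by
    rw [hpow, hpow]
    simp only [mul_assoc]
    rw [← mul_assoc (signMatrix P) (signMatrix P), signMatrix_mul_self, one_mul]
  rw [hprod, signMatrix, mul_diagonal, diagonal_mul]
  simp [← mul_assoc, ← pow_add, ← two_mul]

end Inverse

end BicoloredPoset

/-- If `p°` and `p` are polynomials in `ℚ[X,Y]` computing `Ω°_{P,C}` and
`Ω_{P,C}` respectively on the range `x ≥ 1`, `0 ≤ y ≤ x`, then
`(-1)^n · p°(-X,-Y) = p(X, Y+1)` as polynomials, where `n = |P|`. -/
theorem stmt_2 (P : Type) [Fintype P] [PartialOrder P] (C : Finset P)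
    (pstrict pweak : MvPolynomial (Fin 2) ℚ)
    (hstrict : ∀ x y : ℤ, 1 ≤ x → 0 ≤ y → y ≤ x →
      (Nat.card {φ : P → ℤ //
          (∀ a, 1 ≤ φ a ∧ φ a ≤ x) ∧
          (∀ a b : P, a < b → φ a < φ b) ∧
          (∀ c ∈ C, y < φ c)} : ℚ)
        = MvPolynomial.eval ![(x : ℚ), (y : ℚ)] pstrict)
    (hweak : ∀ x y : ℤ, 1 ≤ x → 0 ≤ y → y ≤ x →
      (Nat.card {φ : P → ℤ //
          (∀ a, 1 ≤ φ a ∧ φ a ≤ x) ∧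
          (∀ a b : P, a ≤ b → φ a ≤ φ b) ∧
          (∀ c ∈ C, y ≤ φ c)} : ℚ)
        = MvPolynomial.eval ![(x : ℚ), (y : ℚ)] pweak) :
    (-1 : MvPolynomial (Fin 2) ℚ) ^ (Fintype.card P) *
        MvPolynomial.aeval ![-MvPolynomial.X 0, -MvPolynomial.X 1] pstrict
      = MvPolynomial.aeval ![MvPolynomial.X 0, MvPolynomial.X 1 + 1] pweak := by
  classical
  have hN : 0 < Fintype.card P + 1 := Nat.succ_pos _
  have hnil := BicoloredPoset.stepMatrix_sub_one_pow (P := P)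
  set N := Fintype.card P + 1
  set η : Finset P → Matrix (Finset P) (Finset P) ℚ :=
    fun B => BicoloredPoset.stepMatrix (· ≤ ·) 0 B - 1
  have hpos : ∀ (B : Finset P) (k : ℕ), BicoloredPoset.binomialSeries N (η B) k =
      BicoloredPoset.stepMatrix (· ≤ ·) 0 B ^ k := fun B k => by
    rw [BicoloredPoset.binomialSeries_natCast hN (hnil B), add_sub_cancel]
  have hneg : ∀ (B : Finset P) (k : ℕ), BicoloredPoset.binomialSeries N (η B) (-k) =
      BicoloredPoset.signedStepMatrix B ^ k := fun B k =>
    BicoloredPoset.binomialSeries_neg_natCast hN (hnil B)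
      (by rw [add_sub_cancel, BicoloredPoset.signedStepMatrix_mul_stepMatrix]) k
  obtain ⟨G, hG⟩ := BicoloredPoset.exists_mvPolynomial_eval_eq_binomialSeries_mul N
    (η ∅) (η C) Finset.univ ∅ (MvPolynomial.X 0 - MvPolynomial.X 1) (MvPolynomial.X 1)
  have hw : pweak = MvPolynomial.aeval ![MvPolynomial.X 0, MvPolynomial.X 1 - 1] G := by
    refine BicoloredPoset.mvPolynomial_ext_of_cone fun m k => ?_
    have h := hweak (m + k + 1 : ℕ) (k + 1 : ℕ) (by push_cast; omega) (by positivity)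
      (by push_cast; omega)
    have h' := BicoloredPoset.card_maps_eq (P := P) (· ≤ ·) le_rfl zero_le_one C (m + 1) k
    rw [Int.cast_natCast, Int.cast_natCast] at h
    rw [← h, BicoloredPoset.eval_aeval_pair, hG]
    simp only [add_zero, add_right_comm m 1 k] at h'
    rw [← hpos, ← hpos] at h'
    convert h' using 4 <;> simp
    ring
  have hs : pstrict = (-1) ^ Fintype.card P *
      MvPolynomial.aeval ![-MvPolynomial.X 0, -MvPolynomial.X 1] G := by
    refine BicoloredPoset.mvPolynomial_ext_of_cone fun m k => ?_
    have h := hstrict (m + k + 1 : ℕ) (k + 1 : ℕ) (by push_cast; omega) (by positivity)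
      (by push_cast; omega)
    have h' := BicoloredPoset.card_maps_eq (P := P) (· < ·) zero_le_one le_rfl C m (k + 1)
    rw [Int.cast_natCast, Int.cast_natCast] at h
    rw [← h, map_mul, BicoloredPoset.eval_aeval_pair, hG]
    rw [BicoloredPoset.stepMatrix_lt_pow_mul_pow_apply, ← hneg, ← hneg] at h'
    simp only [← add_assoc, Int.add_one_le_iff] at h'
    rw [h']
    congr 1 <;> simp
  refine MvPolynomial.funext fun v => ?_
  rw [hw, hs]
  rw [map_mul, BicoloredPoset.eval_aeval_pair, BicoloredPoset.eval_aeval_pair, map_mul,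
    BicoloredPoset.eval_aeval_pair, BicoloredPoset.eval_aeval_pair]
  simp [← mul_assoc, ← pow_add, ← two_mul]
end

section
/- Let P = {a_1 ≺ a_2 ≺ ⋯ ≺ a_n} be a chain with n elements, bicolored by a nonempty celeste set C ⊆ {a_{k+1},…,a_n} whose minimal element is a_{k+1} (where 0 ≤ k ≤ n−1). Then for all integers x and y with x ≥ 1 and 0 ≤ y ≤ x, Ω°_{P,C}(x,y) = Σ_{i=0}^{k} binom(y, i) · binom(x−y, n−i). -/
/-- The generalized binomial coefficient `m(m-1)⋯(m-j+1)/j!` for an integer `m`. -/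
def ibinom (m : ℤ) (j : ℕ) : ℚ :=
  (∏ i ∈ Finset.range j, ((m : ℚ) - i)) / (Nat.factorial j)

theorem ibinom_eq_choose (m : ℤ) (hm : 0 ≤ m) (j : ℕ) : ibinom m j = (m.toNat.choose j : ℚ) := by
  lift m to ℕ using hm
  rw [Int.toNat_natCast, ibinom, Nat.cast_choose_eq_descPochhammer_div,
    descPochhammer_eval_eq_prod_range]
  simp

/-- Subsets of `A ∪ B` with `i` elements in `A` and `j` elements in `B`. -/
theorem card_powersetCard_union_filter_inter {α : Type*} [DecidableEq α] {A B : Finset α}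
    (h : Disjoint A B) (i j : ℕ) :
    (((A ∪ B).powersetCard (i + j)).filter (fun S => (S ∩ A).card = i)).card
      = A.card.choose i * B.card.choose j := by
  rw [← Finset.card_powersetCard, ← Finset.card_powersetCard, ← Finset.card_product]
  refine Finset.card_nbij' (fun S => (S ∩ A, S ∩ B)) (fun T => T.1 ∪ T.2) ?_ ?_ ?_ ?_
  · intro S hS
    simp only [Finset.coe_filter, Finset.mem_powersetCard, Set.mem_ofPred_eq] at hS
    obtain ⟨⟨hS, hc⟩, hi⟩ := hS
    have hu : (S ∩ A) ∪ (S ∩ B) = S := by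
      rw [← Finset.inter_union_distrib_left, Finset.inter_eq_left.2 hS]
    have hd : Disjoint (S ∩ A) (S ∩ B) :=
      h.mono Finset.inter_subset_right Finset.inter_subset_right
    have hsum := Finset.card_union_of_disjoint hd
    rw [hu] at hsum
    simp only [Finset.coe_product, Set.mem_prod, Finset.mem_coe, Finset.mem_powersetCard]
    exact ⟨⟨Finset.inter_subset_right, hi⟩, Finset.inter_subset_right, by omega⟩
  · rintro ⟨S, T⟩ hT
    simp only [Finset.coe_product, Set.mem_prod, Finset.mem_coe, Finset.mem_powersetCard] at hT
    obtain ⟨⟨hS, hi⟩, hT, hj⟩ := hT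
    have hTA : T ∩ A = ∅ := Finset.disjoint_iff_inter_eq_empty.1 (h.symm.mono_left hT)
    simp only [Finset.coe_filter, Finset.mem_powersetCard, Set.mem_ofPred_eq]
    refine ⟨⟨Finset.union_subset_union hS hT, ?_⟩, ?_⟩
    · rw [Finset.card_union_of_disjoint (h.mono hS hT), hi, hj]
    · rw [Finset.union_inter_distrib_right, hTA, Finset.union_empty,
        Finset.inter_eq_left.2 hS, hi]
  · intro S hS
    simp only [Finset.coe_filter, Finset.mem_powersetCard, Set.mem_ofPred_eq] at hS
    simp only [← Finset.inter_union_distrib_left, Finset.inter_eq_left.2 hS.1.1]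
  · rintro ⟨S, T⟩ hT
    simp only [Finset.coe_product, Set.mem_prod, Finset.mem_coe, Finset.mem_powersetCard] at hT
    obtain ⟨⟨hS, hi⟩, hT, hj⟩ := hT
    have hTA : T ∩ A = ∅ := Finset.disjoint_iff_inter_eq_empty.1 (h.symm.mono_left hT)
    have hSB : S ∩ B = ∅ := Finset.disjoint_iff_inter_eq_empty.1 (h.mono_left hS)
    simp only [Finset.union_inter_distrib_right, hTA, hSB, Finset.union_empty, Finset.empty_union,
      Finset.inter_eq_left.2 hS, Finset.inter_eq_left.2 hT]

/-- Strictly increasing sequences of length `n` correspond to their ranges. -/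
theorem card_strictMono_eq_card_filter_powersetCard {α : Type*} [LinearOrder α] (n : ℕ)
    (A : Finset α) (p : Finset α → Prop) [DecidablePred p] :
    Nat.card {φ : Fin n → α // (∀ a, φ a ∈ A) ∧ StrictMono φ ∧ p (Finset.univ.image φ)}
      = ((A.powersetCard n).filter p).card := by
  rw [← Fintype.card_coe, ← Nat.card_eq_fintype_card]
  refine Nat.card_eq_of_bijective (fun φ => ⟨Finset.univ.image φ.1, ?_⟩) ⟨?_, ?_⟩
  · obtain ⟨φ, hA, hm, hp⟩ := φ
    simp only [Finset.mem_filter, Finset.mem_powersetCard]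
    refine ⟨⟨?_, ?_⟩, hp⟩
    · simpa [Finset.image_subset_iff] using hA
    · rw [Finset.card_image_of_injective _ hm.injective, Finset.card_fin]
  · rintro ⟨φ, hA, hm, hp⟩ ⟨ψ, hA', hm', hp'⟩ h
    simp only [Subtype.mk.injEq] at h ⊢
    refine (hm.range_inj hm').1 ?_
    simpa using congrArg (fun S : Finset α => (S : Set α)) h
  · rintro ⟨S, hS⟩
    simp only [Finset.mem_filter, Finset.mem_powersetCard] at hS
    have him : Finset.univ.image (S.orderEmbOfFin hS.1.2) = S := by
      apply Finset.coe_injective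
      simp
    exact ⟨⟨S.orderEmbOfFin hS.1.2, fun a => hS.1.1 (S.orderEmbOfFin_mem _ a),
      (S.orderEmbOfFin hS.1.2).strictMono, by rw [him]; exact hS.2⟩, Subtype.ext him⟩

/-- The `k`-th term of a strictly increasing sequence exceeds `y` if and only if at most `k` of its
terms are at most `y`. -/
theorem StrictMono.lt_apply_iff_card_filter_image_le {α : Type*} [LinearOrder α] {n : ℕ}
    {φ : Fin n → α} (hφ : StrictMono φ) (y : α) (k : Fin n) :
    y < φ k ↔ ((Finset.univ.image φ).filter (· ≤ y)).card ≤ k := by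
  rw [Finset.filter_image, Finset.card_image_of_injective _ hφ.injective]
  constructor
  · intro h
    rw [← Fin.card_Iio k]
    refine Finset.card_le_card fun a ha => ?_
    simp only [Finset.mem_filter, Finset.mem_univ, true_and] at ha
    exact Finset.mem_Iio.2 (hφ.lt_iff_lt.1 (ha.trans_lt h))
  · contrapose!
    intro h
    rw [← Nat.succ_le_iff, Nat.succ_eq_add_one, ← Fin.card_Iic k]
    refine Finset.card_le_card fun a ha => ?_
    simp only [Finset.mem_filter, Finset.mem_univ, true_and]
    exact (hφ.monotone (Finset.mem_Iic.1 ha)).trans h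

/-- For the bicolored chain `a_1 ≺ ⋯ ≺ a_n` (modeled as `Fin n`) with a
nonempty celeste set `C ⊆ {a_{k+1}, …, a_n}` whose minimal element is `a_{k+1}`
(index `k` in `Fin n`), for all integers `x ≥ 1` and `0 ≤ y ≤ x`,
`Ω°_{P,C}(x,y) = Σ_{i=0}^{k} binom(y,i) binom(x-y,n-i)`. -/
theorem stmt_3 (n k : ℕ) (hn : 1 ≤ n) (hk : k ≤ n - 1)
    (C : Finset (Fin n))
    (hCk : ∀ c ∈ C, k ≤ (c : ℕ))
    (hmin : ∃ hkn : k < n, (⟨k, hkn⟩ : Fin n) ∈ C)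
    (x y : ℤ) (hx : 1 ≤ x) (hy : 0 ≤ y) (hyx : y ≤ x) :
    (Nat.card {φ : Fin n → ℤ //
        (∀ a, 1 ≤ φ a ∧ φ a ≤ x) ∧
        (∀ a b : Fin n, a < b → φ a < φ b) ∧
        (∀ c ∈ C, y < φ c)} : ℚ)
      = ∑ i ∈ Finset.range (k + 1), ibinom y i * ibinom (x - y) (n - i) := by
  obtain ⟨hkn, hkC⟩ := hmin
  have hdisj : Disjoint (Finset.Icc 1 y) (Finset.Icc (y + 1) x) := by
    rw [Finset.disjoint_left]
    intro a
    simp only [Finset.mem_Icc]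
    omega
  have hunion : Finset.Icc 1 y ∪ Finset.Icc (y + 1) x = Finset.Icc 1 x := by
    ext a
    simp only [Finset.mem_union, Finset.mem_Icc]
    omega
  have hmaps : Nat.card {φ : Fin n → ℤ //
        (∀ a, 1 ≤ φ a ∧ φ a ≤ x) ∧ (∀ a b : Fin n, a < b → φ a < φ b) ∧ (∀ c ∈ C, y < φ c)}
      = Nat.card {φ : Fin n → ℤ // (∀ a, φ a ∈ Finset.Icc 1 x) ∧ StrictMono φ ∧
          ((Finset.univ.image φ).filter (· ≤ y)).card ≤ k} := by
    refine Nat.card_congr (Equiv.subtypeEquivRight fun φ => ?_)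
    simp only [Finset.mem_Icc]
    refine and_congr_right fun _ => and_congr_right fun h => ?_
    have hφ : StrictMono φ := fun a b => h a b
    refine Iff.trans ⟨fun hC => hC _ hkC, fun hlt c hc => hlt.trans_le (hφ.monotone (hCk c hc))⟩
      (hφ.lt_apply_iff_card_filter_image_le y ⟨k, hkn⟩)
  rw [hmaps, card_strictMono_eq_card_filter_powersetCard n (Finset.Icc 1 x)
      (fun S => (S.filter (· ≤ y)).card ≤ k),
    Finset.card_eq_sum_card_fiberwise (f := fun S => (S.filter (· ≤ y)).card)
      (t := Finset.range (k + 1))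
      (fun S hS => by simpa [Nat.lt_succ_iff] using (Finset.mem_filter.1 hS).2)]
  push_cast
  refine Finset.sum_congr rfl fun i hi => ?_
  have hik : i ≤ k := Nat.lt_succ_iff.1 (Finset.mem_range.1 hi)
  rw [ibinom_eq_choose y hy, ibinom_eq_choose (x - y) (by omega), ← Nat.cast_mul]
  have hcount := card_powersetCard_union_filter_inter hdisj i (n - i)
  rw [hunion, Nat.add_sub_cancel' (by omega), Int.card_Icc, Int.card_Icc, add_sub_cancel_right,
    show x + 1 - (y + 1) = x - y by ring] at hcount
  rw [← hcount, Finset.filter_filter]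
  congr 2
  refine Finset.filter_congr fun S hS => ?_
  have hSy : S.filter (· ≤ y) = S ∩ Finset.Icc 1 y := by
    ext a
    simp only [Finset.mem_filter, Finset.mem_inter, Finset.mem_Icc]
    exact and_congr_right fun ha =>
      ⟨fun h => ⟨(Finset.mem_Icc.1 ((Finset.mem_powersetCard.1 hS).1 ha)).1, h⟩, fun h => h.2⟩
  rw [hSy]
  omega
end

section
/- Let (P,C) be a bicolored poset with n elements and nonempty celeste set C, let ω : P → {1,…,n} be a bijective labeling, and let L : a_1 ≺_L a_2 ≺_L ⋯ ≺_L a_n be a linear extension of P with associated word ω_L. Let a_{k+1} be the minimal celeste element with respect to L and let ω̃_L = ω(a_1)ω(a_2)⋯ω(a_{k+1}) be the corresponding prefix word. Then for all integers x and y with x ≥ 1 and 0 ≤ y ≤ x, Ω°_{ω_L}(x,y) = Σ_{i=0}^{k} binom(y + asc(ω̃_L), i) · binom(x − y + asc(ω_L) − asc(ω̃_L), n−i). -/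
/-- Number of ascents among the first `m` consecutive pairs of the word
`ω(a 0) ω(a 1) ⋯ ω(a (n-1))`: positions `i` with `i < m`, `i+1 < n`, and
`ω(a i) < ω(a (i+1))`.  Taking `m = n` gives `asc` of the full word; taking `m = k`
gives `asc` of the prefix word of length `k+1`. -/
noncomputable def ascCount {P : Type} (n : ℕ) (ω : P → ℕ) (a : Fin n ≃ P) (m : ℕ) : ℕ :=
  Nat.card {i : Fin n //
    ∃ h : (i : ℕ) + 1 < n, (i : ℕ) < m ∧ ω (a i) < ω (a ⟨(i : ℕ) + 1, h⟩)}

/-- Number of type-`ω_L` maps `φ` with `1 ≤ φ ≤ x`, weak inequalities at ascents, strict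
inequalities at descents, and `φ(c) > y` for all celeste `c`. -/
noncomputable def typeMapsStrict {P : Type} (n : ℕ) (ω : P → ℕ) (a : Fin n ≃ P) (C : Finset P)
    (x y : ℤ) : ℕ :=
  Nat.card {φ : P → ℤ //
    (∀ v, 1 ≤ φ v ∧ φ v ≤ x) ∧
    (∀ i j : Fin n, (i : ℕ) + 1 = (j : ℕ) →
      if ω (a i) < ω (a j) then φ (a i) ≤ φ (a j) else φ (a i) < φ (a j)) ∧
    (∀ c ∈ C, y < φ c)}

theorem ibinom_natCast (m j : ℕ) : ibinom (m : ℤ) j = (m.choose j : ℚ) := by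
  have h : (∏ i ∈ Finset.range j, (((m : ℤ) : ℚ) - i)) = (m.descFactorial j : ℚ) := by
    rw [Int.cast_natCast, ← descPochhammer_eval_eq_prod_range, descPochhammer_eval_eq_descFactorial]
  rw [ibinom, h, Nat.descFactorial_eq_factorial_mul_choose, Nat.cast_mul,
    mul_div_cancel_left₀ _ (by exact_mod_cast j.factorial_ne_zero)]

open Classical in
theorem ascCount_eq_card_filter {P : Type} (n : ℕ) (ω : P → ℕ) (a : Fin n ≃ P) (m : ℕ) :
    ascCount n ω a m = ((Finset.range m).filter fun i =>
      ∃ h : i + 1 < n, ω (a ⟨i, by omega⟩) < ω (a ⟨i + 1, h⟩)).card := by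
  rw [ascCount, Nat.card_eq_fintype_card, Fintype.card_subtype]
  refine Finset.card_bij (fun i _ => (i : ℕ)) ?_ ?_ ?_
  · intro i hi
    obtain ⟨h, h1, h2⟩ := (Finset.mem_filter.1 hi).2
    exact Finset.mem_filter.2 ⟨Finset.mem_range.2 h1, h, h2⟩
  · intro i _ j _ h
    exact Fin.ext h
  · intro i hi
    obtain ⟨h1, h, h2⟩ := Finset.mem_filter.1 hi
    exact ⟨⟨i, by omega⟩,
      Finset.mem_filter.2 ⟨Finset.mem_univ _, h, Finset.mem_range.1 h1, h2⟩, rfl⟩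

theorem ascCount_zero {P : Type} (n : ℕ) (ω : P → ℕ) (a : Fin n ≃ P) :
    ascCount n ω a 0 = 0 := by
  simp [ascCount_eq_card_filter]

theorem ascCount_mono {P : Type} (n : ℕ) (ω : P → ℕ) (a : Fin n ≃ P) :
    Monotone (ascCount n ω a) := by
  classical
  intro m m' h
  rw [ascCount_eq_card_filter, ascCount_eq_card_filter]
  exact Finset.card_le_card (Finset.filter_subset_filter _ (Finset.range_subset_range.2 h))

theorem ascCount_succ {P : Type} (n : ℕ) (ω : P → ℕ) (a : Fin n ≃ P) (i j : Fin n)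
    (hij : (i : ℕ) + 1 = j) :
    ascCount n ω a j = ascCount n ω a i + if ω (a i) < ω (a j) then 1 else 0 := by
  classical
  obtain ⟨i, hi⟩ := i
  obtain ⟨j, hj⟩ := j
  dsimp only at hij
  subst hij
  rw [ascCount_eq_card_filter, ascCount_eq_card_filter, Finset.range_add_one,
    Finset.filter_insert]
  split_ifs with h1 h2 h2
  · rw [Finset.card_insert_of_notMem (by simp)]
  · exact absurd h1.2 h2
  · exact absurd ⟨hj, h2⟩ h1
  · rfl

theorem ascCount_succ_self {P : Type} (m : ℕ) (ω : P → ℕ) (a : Fin (m + 1) ≃ P) :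
    ascCount (m + 1) ω a (m + 1) = ascCount (m + 1) ω a m := by
  classical
  rw [ascCount_eq_card_filter, ascCount_eq_card_filter, Finset.range_add_one,
    Finset.filter_insert, if_neg]
  rintro ⟨h, _⟩
  omega

theorem Fin.strictMono_of_lt_next {α : Type*} [Preorder α] {n : ℕ} {f : Fin n → α}
    (h : ∀ i j : Fin n, (i : ℕ) + 1 = j → f i < f j) : StrictMono f := by
  cases n with
  | zero => exact fun i => i.elim0
  | succ m => exact Fin.strictMono_iff_lt_succ.2 fun i => h _ _ (by simp)

theorem Fin.monotone_of_le_next {α : Type*} [Preorder α] {n : ℕ} {f : Fin n → α}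
    (h : ∀ i j : Fin n, (i : ℕ) + 1 = j → f i ≤ f j) : Monotone f := by
  cases n with
  | zero => exact fun i => i.elim0
  | succ m => exact Fin.monotone_iff_le_succ.2 fun i => h _ _ (by simp)

theorem card_filter_le_image_le_iff {n : ℕ} {f : Fin n → ℤ} (hf : StrictMono f) (k : Fin n)
    (M : ℤ) :
    ((Finset.univ.image f).filter (· ≤ M)).card ≤ (k : ℕ) ↔ M < f k := by
  rw [Finset.filter_image, Finset.card_image_of_injective _ hf.injective]
  constructor
  · intro h
    by_contra! hk
    have : (Finset.Iic k).card ≤ (Finset.univ.filter fun i => f i ≤ M).card :=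
      Finset.card_le_card fun i hi =>
        Finset.mem_filter.2 ⟨Finset.mem_univ _, (hf.monotone (Finset.mem_Iic.1 hi)).trans hk⟩
    rw [Fin.card_Iic] at this
    omega
  · intro h
    rw [← Fin.card_Iio k]
    refine Finset.card_le_card fun i hi => Finset.mem_Iio.2 (hf.lt_iff_lt.1 ?_)
    exact (Finset.mem_filter.1 hi).2.trans_lt h

theorem card_powersetCard_filter_inter {α : Type*} [DecidableEq α] (V W : Finset α)
    (hVW : Disjoint V W) (n i : ℕ) (hi : i ≤ n) :
    (((V ∪ W).powersetCard n).filter fun S => (S ∩ V).card = i).card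
      = V.card.choose i * W.card.choose (n - i) := by
  rw [← Finset.card_powersetCard, ← Finset.card_powersetCard, ← Finset.card_product]
  refine Finset.card_nbij' (fun S => (S ∩ V, S ∩ W)) (fun p => p.1 ∪ p.2) ?_ ?_ ?_ ?_
  · intro S hS
    simp only [Finset.coe_filter, Finset.mem_powersetCard, Set.mem_ofPred_eq] at hS
    obtain ⟨⟨hsub, hc⟩, hSi⟩ := hS
    have h1 : (S ∩ V ∪ S ∩ W).card = (S ∩ V).card + (S ∩ W).card :=
      Finset.card_union_of_disjoint
        (hVW.mono Finset.inter_subset_right Finset.inter_subset_right)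
    rw [← Finset.inter_union_distrib_left, Finset.inter_eq_left.2 hsub] at h1
    simp only [Finset.coe_product, Set.mem_prod, Finset.mem_coe, Finset.mem_powersetCard]
    exact ⟨⟨Finset.inter_subset_right, hSi⟩, Finset.inter_subset_right, by omega⟩
  · rintro ⟨A, B⟩ h
    simp only [Finset.coe_product, Set.mem_prod, Finset.mem_coe, Finset.mem_powersetCard] at h
    obtain ⟨⟨hA, hAc⟩, hB, hBc⟩ := h
    have h1 : (A ∪ B) ∩ V = A := by
      rw [Finset.union_inter_distrib_right, Finset.inter_eq_left.2 hA,
        Finset.disjoint_iff_inter_eq_empty.1 (hVW.symm.mono_left hB), Finset.union_empty]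
    simp only [Finset.coe_filter, Finset.mem_powersetCard, Set.mem_ofPred_eq]
    refine ⟨⟨Finset.union_subset_union hA hB, ?_⟩, by rw [h1, hAc]⟩
    rw [Finset.card_union_of_disjoint (hVW.mono hA hB)]
    omega
  · intro S hS
    simp only [Finset.coe_filter, Finset.mem_powersetCard, Set.mem_ofPred_eq] at hS
    exact (Finset.inter_union_distrib_left _ _ _).symm.trans (Finset.inter_eq_left.2 hS.1.1)
  · rintro ⟨A, B⟩ h
    simp only [Finset.coe_product, Set.mem_prod, Finset.mem_coe, Finset.mem_powersetCard] at h
    obtain ⟨⟨hA, hAc⟩, hB, hBc⟩ := h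
    simp only [Prod.mk.injEq]
    constructor
    · rw [Finset.union_inter_distrib_right, Finset.inter_eq_left.2 hA,
        Finset.disjoint_iff_inter_eq_empty.1 (hVW.symm.mono_left hB), Finset.union_empty]
    · rw [Finset.union_inter_distrib_right, Finset.inter_eq_left.2 hB,
        Finset.disjoint_iff_inter_eq_empty.1 (hVW.mono_left hA), Finset.empty_union]

theorem card_powersetCard_filter_inter_le {α : Type*} [DecidableEq α] (V W : Finset α)
    (hVW : Disjoint V W) (n k : ℕ) (hk : k ≤ n) :
    (((V ∪ W).powersetCard n).filter fun S => (S ∩ V).card ≤ k).card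
      = ∑ i ∈ Finset.range (k + 1), V.card.choose i * W.card.choose (n - i) := by
  rw [Finset.card_eq_sum_card_fiberwise (f := fun S => (S ∩ V).card)
    (t := Finset.range (k + 1))]
  · refine Finset.sum_congr rfl fun i hi => ?_
    have hik := Finset.mem_range.1 hi
    rw [← card_powersetCard_filter_inter V W hVW n i (by omega), Finset.filter_filter]
    congr 1
    refine Finset.filter_congr fun S _ => ?_
    omega
  · intro S hS
    have := (Finset.mem_filter.1 hS).2
    simp only [Finset.coe_range, Set.mem_Iio]
    omega

theorem typeMapsStrict_eq_card {P : Type} (n : ℕ) (ω : P → ℕ) (a : Fin n ≃ P) (C : Finset P)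
    (k : ℕ) (hkn : k < n) (hmin : a ⟨k, hkn⟩ ∈ C)
    (hpos : ∀ i : Fin n, a i ∈ C → k ≤ (i : ℕ)) (x y : ℤ) :
    typeMapsStrict n ω a C x y
      = (((Finset.Ioc (0 : ℤ) (x + ascCount n ω a n)).powersetCard n).filter fun S =>
          (S.filter (· ≤ y + ascCount n ω a k)).card ≤ k).card := by
  classical
  have hsucc := ascCount_succ n ω a
  have hmono := ascCount_mono n ω a
  set A : ℕ → ℕ := ascCount n ω a with hA
  have hstrict : ∀ φ : P → ℤ, (∀ i j : Fin n, (i : ℕ) + 1 = (j : ℕ) →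
      if ω (a i) < ω (a j) then φ (a i) ≤ φ (a j) else φ (a i) < φ (a j)) →
      StrictMono fun i : Fin n => φ (a i) + A i := by
    intro φ h
    refine Fin.strictMono_of_lt_next fun i j hij => ?_
    have h1 := h i j hij
    have h2 := hsucc i j hij
    split_ifs at h1 h2 <;> omega
  have hself : ∀ i : Fin n, (i : ℕ) + 1 = n → A n = A i := by
    intro i hi
    obtain ⟨i, _⟩ := i
    dsimp only at hi
    subst hi
    exact ascCount_succ_self i ω a
  rw [← Nat.card_eq_finsetCard, typeMapsStrict]
  refine Nat.card_eq_of_bijective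
    (fun φ => ⟨Finset.univ.image fun i : Fin n => φ.1 (a i) + A i, ?_⟩) ⟨?_, ?_⟩
  · obtain ⟨φ, hb, hφ, hC⟩ := φ
    have hs := hstrict φ hφ
    refine Finset.mem_filter.2 ⟨Finset.mem_powersetCard.2 ⟨fun z hz => ?_, ?_⟩, ?_⟩
    · obtain ⟨i, -, rfl⟩ := Finset.mem_image.1 hz
      have h1 := hb (a i)
      have h2 := hmono i.isLt.le
      rw [Finset.mem_Ioc]
      dsimp only
      omega
    · rw [Finset.card_image_of_injective _ hs.injective, Finset.card_fin]
    · refine (card_filter_le_image_le_iff hs ⟨k, hkn⟩ _).2 ?_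
      have := hC _ hmin
      dsimp only
      omega
  · rintro ⟨φ, hb, hφ, hC⟩ ⟨φ', hb', hφ', hC'⟩ h
    have h1 : (Finset.univ.image fun i : Fin n => φ (a i) + A i)
        = Finset.univ.image fun i : Fin n => φ' (a i) + A i := congrArg Subtype.val h
    have h2 := congrArg (fun s : Finset ℤ => (s : Set ℤ)) h1
    simp only [Finset.coe_image, Finset.coe_univ, Set.image_univ] at h2
    have h3 := ((hstrict φ hφ).range_inj (hstrict φ' hφ')).1 h2
    refine Subtype.ext (funext fun v => ?_)
    have h4 := congrFun h3 (a.symm v)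
    simp only [Equiv.apply_symm_apply] at h4
    dsimp only
    omega
  · rintro ⟨S, hS⟩
    obtain ⟨hS, hSk⟩ := Finset.mem_filter.1 hS
    obtain ⟨hSsub, hSc⟩ := Finset.mem_powersetCard.1 hS
    set e := S.orderEmbOfFin hSc with he
    have himage : Finset.univ.image e = S := Finset.image_orderEmbOfFin_univ S hSc
    have hstep : ∀ i j : Fin n, (i : ℕ) + 1 = j →
        if ω (a i) < ω (a j) then e i - A i ≤ e j - A j else e i - A i < e j - A j := by
      intro i j hij
      have h1 : e i < e j := e.strictMono (Fin.lt_def.2 (by omega))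
      have h2 := hsucc i j hij
      split_ifs at h2 ⊢ <;> omega
    have hm : Monotone fun i : Fin n => e i - A i := by
      refine Fin.monotone_of_le_next fun i j hij => ?_
      have := hstep i j hij
      split_ifs at this
      · exact this
      · exact this.le
    have hmem : ∀ i, 0 < e i ∧ e i ≤ x + A n := fun i =>
      Finset.mem_Ioc.1 (hSsub (S.orderEmbOfFin_mem hSc i))
    have hk : y + A k < e ⟨k, hkn⟩ := by
      rw [← himage] at hSk
      exact (card_filter_le_image_le_iff e.strictMono ⟨k, hkn⟩ _).1 hSk
    refine ⟨⟨fun v => e (a.symm v) - A (a.symm v), fun v => ⟨?_, ?_⟩, ?_, fun c hc => ?_⟩, ?_⟩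
    · have h1 := hm (show (⟨0, by omega⟩ : Fin n) ≤ a.symm v from Nat.zero_le _)
      have h2 := (hmem ⟨0, by omega⟩).1
      have h3 : A 0 = 0 := ascCount_zero n ω a
      dsimp only at h1 ⊢
      omega
    · have h1 := hm (show a.symm v ≤ (⟨n - 1, by omega⟩ : Fin n) from
        Fin.le_def.2 (by dsimp only; omega))
      have h2 := (hmem ⟨n - 1, by omega⟩).2
      have h3 := hself ⟨n - 1, by omega⟩ (by dsimp only; omega)
      dsimp only at h1 h3 ⊢
      omega
    · intro i j hij
      simpa only [Equiv.symm_apply_apply] using hstep i j hij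
    · have h1 := hm (show (⟨k, hkn⟩ : Fin n) ≤ a.symm c from
        hpos _ (by rwa [Equiv.apply_symm_apply]))
      dsimp only at h1 ⊢
      omega
    · refine Subtype.ext ?_
      simp only [Equiv.symm_apply_apply, sub_add_cancel]
      exact himage

/-- Let `(P,C)` be a bicolored poset with `n` elements and nonempty celeste
set, `ω : P → {1,…,n}` a bijective labeling, `L : a_1 ≺_L ⋯ ≺_L a_n` a linear extension
of `P` (here `a : Fin n ≃ P` with `a i ≤_P a j → i ≤ j`), `a_{k+1}` (index `k`) the
minimal celeste element w.r.t. `L`.  Then for integers `x ≥ 1`, `0 ≤ y ≤ x`,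
`Ω°_{ω_L}(x,y) = Σ_{i=0}^{k} binom(y + asc(ω̃_L), i) · binom(x - y + asc(ω_L) - asc(ω̃_L), n-i)`. -/
theorem stmt_6 (P : Type) [Fintype P] [PartialOrder P] (n : ℕ)
    (hcard : Fintype.card P = n) (C : Finset P) (hC : C.Nonempty)
    (ω : P → ℕ) (hω1 : ∀ v, ω v ∈ Finset.Icc 1 n) (hω2 : Function.Injective ω)
    (a : Fin n ≃ P) (hext : ∀ i j : Fin n, a i ≤ a j → i ≤ j)
    (k : ℕ) (hkn : k < n) (hmin : a ⟨k, hkn⟩ ∈ C)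
    (hpos : ∀ i : Fin n, a i ∈ C → k ≤ (i : ℕ))
    (x y : ℤ) (hx : 1 ≤ x) (hy : 0 ≤ y) (hyx : y ≤ x) :
    (typeMapsStrict n ω a C x y : ℚ)
      = ∑ i ∈ Finset.range (k + 1),
          ibinom (y + (ascCount n ω a k : ℤ)) i *
            ibinom (x - y + (ascCount n ω a n : ℤ) - (ascCount n ω a k : ℤ)) (n - i) := by
  have hA := ascCount_mono n ω a hkn.le
  set A := ascCount n ω a
  obtain ⟨M, hM⟩ := Int.eq_ofNat_of_zero_le (show 0 ≤ y + (A k : ℤ) by omega)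
  obtain ⟨N, hN⟩ := Int.eq_ofNat_of_zero_le (show 0 ≤ x - y + (A n : ℤ) - (A k : ℤ) by omega)
  have hdisj : Disjoint (Finset.Ioc (0 : ℤ) M) (Finset.Ioc (M : ℤ) (M + N)) :=
    Finset.disjoint_left.2 fun z h1 h2 => by
      rw [Finset.mem_Ioc] at h1 h2
      omega
  have hunion : Finset.Ioc (0 : ℤ) (x + A n)
      = Finset.Ioc (0 : ℤ) M ∪ Finset.Ioc (M : ℤ) (M + N) := by
    ext z
    simp only [Finset.mem_union, Finset.mem_Ioc]
    omega
  have key : typeMapsStrict n ω a C x y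
      = ∑ i ∈ Finset.range (k + 1), M.choose i * N.choose (n - i) := by
    have h := card_powersetCard_filter_inter_le _ _ hdisj n k hkn.le
    rw [Int.card_Ioc, Int.card_Ioc, sub_zero, add_sub_cancel_left, Int.toNat_natCast,
      Int.toNat_natCast] at h
    rw [typeMapsStrict_eq_card n ω a C k hkn hmin hpos, ← h]
    change (((Finset.Ioc (0 : ℤ) (x + A n)).powersetCard n).filter fun S =>
      (S.filter (· ≤ y + (A k : ℤ))).card ≤ k).card = _
    rw [hM, hunion]
    congr 1
    refine Finset.filter_congr fun S hS => ?_
    have hsub := (Finset.mem_powersetCard.1 hS).1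
    have hSM : S.filter (· ≤ (M : ℤ)) = S ∩ Finset.Ioc (0 : ℤ) M := by
      ext z
      rw [Finset.mem_filter, Finset.mem_inter, Finset.mem_Ioc]
      refine and_congr_right fun hz => ?_
      have := hsub hz
      simp only [Finset.mem_union, Finset.mem_Ioc] at this
      omega
    rw [hSM]
  rw [key, hM, hN]
  push_cast [ibinom_natCast]
  rfl
end

section
/- Let (P,C) be a bicolored poset with n elements and let ω : P → {1,…,n} be a reverse natural labeling, i.e., a bijection such that a ≺ b in P implies ω(a) > ω(b). Then for all integers x ≥ 1 and y ≥ 0, Ω°_{P,C}(x,y) = Σ_L Ω°_{ω_L}(x,y), where the sum is over all linear extensions L of P. -/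
/-- An injective key into a linear order is sorted by exactly one enumeration. -/
theorem existsUnique_equiv_strictMono_comp {P α : Type*} [Fintype P] [LinearOrder α] {n : ℕ}
    (hcard : Fintype.card P = n) {key : P → α} (hkey : Function.Injective key) :
    ∃! e : Fin n ≃ P, StrictMono (key ∘ e) := by
  have hsorted : ∃ e : Fin n ≃ P, StrictMono (key ∘ e) := by
    let : LinearOrder P := LinearOrder.lift' key hkey
    exact ⟨(Fintype.orderIsoFinOfCardEq P hcard).toEquiv,
      fun _ _ h => (Fintype.orderIsoFinOfCardEq P hcard).strictMono h⟩
  obtain ⟨e, he⟩ := hsorted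
  refine ⟨e, he, fun e' he' => ?_⟩
  have hrange : Set.range (key ∘ e') = Set.range (key ∘ e) := by
    rw [Set.range_comp, Set.range_comp, e.surjective.range_eq, e'.surjective.range_eq]
  have heq := (StrictMono.range_inj he' he).1 hrange
  exact Equiv.ext fun i => hkey (congrFun heq i)

/-- A function on `Fin n` is strictly monotone iff it increases between consecutive indices. -/
theorem Fin.strictMono_iff_lt_of_val_add_one_eq {α : Type*} [Preorder α] {n : ℕ} {f : Fin n → α} :
    StrictMono f ↔ ∀ i j : Fin n, (i : ℕ) + 1 = (j : ℕ) → f i < f j := by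
  refine ⟨fun h i j hij => h (Fin.lt_def.2 (by omega)), fun h => ?_⟩
  cases n with
  | zero => exact fun i => i.elim0
  | succ m => exact Fin.strictMono_iff_lt_succ.2 fun i => h _ _ (by simp)

/-- The type-`ω_L` inequalities say that the enumeration sorts by value, then by label. -/
theorem typeMap_iff_strictMono {P : Type*} {n : ℕ} {ω : P → ℕ} (hω : Function.Injective ω)
    (a : Fin n ≃ P) (φ : P → ℤ) :
    (∀ i j : Fin n, (i : ℕ) + 1 = (j : ℕ) →
      if ω (a i) < ω (a j) then φ (a i) ≤ φ (a j) else φ (a i) < φ (a j)) ↔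
    StrictMono ((fun v => toLex (φ v, ω v)) ∘ a) := by
  rw [Fin.strictMono_iff_lt_of_val_add_one_eq]
  refine forall₃_congr fun i j hij => ?_
  have hne : ω (a i) ≠ ω (a j) := fun h => by
    have := a.injective (hω h)
    subst this
    omega
  simp only [Function.comp_apply, Prod.Lex.toLex_lt_toLex]
  split_ifs <;> omega

/-- Counting a predicate by partitioning it over a finite set of indices. -/
theorem Nat.card_subtype_eq_sum_of_existsUnique {α ι : Type*} {p : α → Prop} {q : ι → α → Prop}
    (S : Finset ι) [∀ i, Finite {a // q i a}] (hqp : ∀ i ∈ S, ∀ a, q i a → p a)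
    (hpq : ∀ a, p a → ∃! i, i ∈ S ∧ q i a) :
    Nat.card {a // p a} = ∑ i ∈ S, Nat.card {a // q i a} := by
  rw [← Finset.sum_coe_sort, ← Nat.card_sigma]
  symm
  refine Nat.card_congr (Equiv.ofBijective
    (fun s : Σ i : S, {a // q i a} => (⟨s.2.1, hqp s.1 s.1.2 _ s.2.2⟩ : {a // p a})) ⟨?_, ?_⟩)
  · rintro ⟨⟨i, hi⟩, a, ha⟩ ⟨⟨j, hj⟩, b, hb⟩ h
    obtain rfl : a = b := congrArg Subtype.val h
    obtain rfl : i = j := (hpq a (hqp i hi a ha)).unique ⟨hi, ha⟩ ⟨hj, hb⟩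
    rfl
  · rintro ⟨a, ha⟩
    obtain ⟨i, ⟨hi, hq⟩, -⟩ := hpq a ha
    exact ⟨⟨⟨i, hi⟩, a, hq⟩, rfl⟩

open scoped Classical in
/-- Let `(P,C)` be a bicolored poset with `n` elements and let
`ω : P → {1,…,n}` be a reverse natural labeling.  Then for all integers `x ≥ 1`, `y ≥ 0`,
`Ω°_{P,C}(x,y) = Σ_L Ω°_{ω_L}(x,y)`, the sum over all linear extensions `L` of `P`
(encoded as equivalences `e : Fin n ≃ P` with `e i ≤_P e j → i ≤ j`). -/
theorem stmt_9 (P : Type) [Fintype P] [PartialOrder P] (n : ℕ)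
    (hcard : Fintype.card P = n) (C : Finset P)
    (ω : P → ℕ) (hω1 : ∀ v, ω v ∈ Finset.Icc 1 n) (hω2 : Function.Injective ω)
    (hrev : ∀ v w : P, v < w → ω w < ω v)
    (x y : ℤ) (hx : 1 ≤ x) (hy : 0 ≤ y) :
    Nat.card {φ : P → ℤ //
        (∀ v, 1 ≤ φ v ∧ φ v ≤ x) ∧
        (∀ v w : P, v < w → φ v < φ w) ∧
        (∀ c ∈ C, y < φ c)}
      = ∑ e ∈ Finset.univ.filter
            (fun e : Fin n ≃ P => ∀ i j : Fin n, e i ≤ e j → i ≤ j),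
          typeMapsStrict n ω e C x y := by
  have hkey (φ : P → ℤ) : Function.Injective fun v => toLex (φ v, ω v) := fun v w h =>
    hω2 (congrArg (fun k => (ofLex k).2) h)
  have hfin (e : Fin n ≃ P) : Finite {φ : P → ℤ //
      (∀ v, 1 ≤ φ v ∧ φ v ≤ x) ∧
      (∀ i j : Fin n, (i : ℕ) + 1 = (j : ℕ) →
        if ω (e i) < ω (e j) then φ (e i) ≤ φ (e j) else φ (e i) < φ (e j)) ∧
      (∀ c ∈ C, y < φ c)} :=
    Set.Finite.subset (Set.Finite.pi' fun _ : P => Set.finite_Icc (1 : ℤ) x) fun _ hφ => hφ.1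
  refine Nat.card_subtype_eq_sum_of_existsUnique _ ?_ ?_
  · rintro e he φ ⟨hbd, htype, hC⟩
    rw [Finset.mem_filter] at he
    rw [typeMap_iff_strictMono hω2] at htype
    refine ⟨hbd, fun v w hvw => ?_, hC⟩
    have hle : e.symm v ≤ e.symm w := he.2 _ _ (by simpa using hvw.le)
    have hlex := htype.monotone hle
    simp only [Function.comp_apply, Equiv.apply_symm_apply, Prod.Lex.toLex_le_toLex] at hlex
    have := hrev v w hvw
    omega
  · rintro φ ⟨hbd, hmono, hC⟩
    obtain ⟨e, he, huniq⟩ := existsUnique_equiv_strictMono_comp hcard (hkey φ)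
    refine ⟨e, ⟨Finset.mem_filter.2 ⟨Finset.mem_univ _, fun i j hij => ?_⟩, hbd,
      (typeMap_iff_strictMono hω2 e φ).2 he, hC⟩,
      fun e' he' => huniq e' ((typeMap_iff_strictMono hω2 e' φ).1 he'.2.2.1)⟩
    rcases hij.eq_or_lt with h | h
    · exact (e.injective h).le
    · exact (he.lt_iff_lt.1 (Prod.Lex.toLex_lt_toLex.2 (Or.inl (hmono _ _ h)))).le
end

section
/- Let (P,C) be a bicolored poset with n elements and let τ : P → {1,…,n} be a natural labeling, i.e., a bijection such that a ≺ b in P implies τ(a) < τ(b). Then for all integers x ≥ 1 and y ≥ 0, Ω_{P,C}(x,y) = Σ_L Ω_{τ_L}(x,y), where the sum is over all linear extensions L of P. -/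
/-- Number of type-`τ_L` maps `φ` with `1 ≤ φ ≤ x`, weak inequalities at ascents of the
word (positions `i` with `τ(a i) < τ(a (i+1))`), strict inequalities at descents, and
`φ(c) ≥ y` for all celeste `c`. -/
noncomputable def typeMapsWeak {P : Type} (n : ℕ) (τ : P → ℕ) (a : Fin n ≃ P)
    (C : Finset P) (x y : ℤ) : ℕ :=
  Nat.card {φ : P → ℤ //
    (∀ v, 1 ≤ φ v ∧ φ v ≤ x) ∧
    (∀ i j : Fin n, (i : ℕ) + 1 = (j : ℕ) →
      if τ (a i) < τ (a j) then φ (a i) ≤ φ (a j) else φ (a i) < φ (a j)) ∧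
    (∀ c ∈ C, y ≤ φ c)}

/-- The elements ordered lexicographically by the value of `φ`, ties being broken by `τ`. -/
def lexKey {P : Type} (τ : P → ℕ) (φ : P → ℤ) (v : P) : ℤ ×ₗ ℕ := toLex (φ v, τ v)

theorem lexKey_injective {P : Type} {τ : P → ℕ} (hτ : Function.Injective τ) (φ : P → ℤ) :
    Function.Injective (lexKey τ φ) := fun _ _ h =>
  hτ (congrArg (fun p : ℤ ×ₗ ℕ => (ofLex p).2) h)

theorem lexKey_lt_iff {P : Type} {τ : P → ℕ} (hτ : Function.Injective τ) (φ : P → ℤ)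
    {v w : P} (hvw : v ≠ w) :
    lexKey τ φ v < lexKey τ φ w ↔ if τ v < τ w then φ v ≤ φ w else φ v < φ w := by
  have := hτ.ne hvw
  simp only [lexKey, Prod.Lex.toLex_lt_toLex]
  split_ifs <;> omega

theorem le_of_lexKey_le {P : Type} {τ : P → ℕ} {φ : P → ℤ} {v w : P}
    (h : lexKey τ φ v ≤ lexKey τ φ w) : φ v ≤ φ w := by
  simp only [lexKey, Prod.Lex.toLex_le_toLex] at h
  omega

/-- The word conditions say exactly that the enumeration is increasing for the key. -/
theorem word_conditions_iff_strictMono {P : Type} {n : ℕ} {τ : P → ℕ}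
    (hτ : Function.Injective τ) (φ : P → ℤ) (e : Fin n ≃ P) :
    (∀ i j : Fin n, (i : ℕ) + 1 = (j : ℕ) →
      if τ (e i) < τ (e j) then φ (e i) ≤ φ (e j) else φ (e i) < φ (e j)) ↔
      StrictMono (lexKey τ φ ∘ e) := by
  have hne : ∀ i j : Fin n, (i : ℕ) < j → e i ≠ e j := fun i j h h' => by
    have := congrArg Fin.val (e.injective h')
    omega
  constructor
  · intro h
    cases n with
    | zero => exact fun i => i.elim0
    | succ n =>
      refine Fin.strictMono_iff_lt_succ.2 fun i => ?_
      exact (lexKey_lt_iff hτ φ (hne _ _ (by simp))).2 (h _ _ (by simp))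
  · intro h i j hij
    exact (lexKey_lt_iff hτ φ (hne i j (by omega))).1 (h (Fin.lt_def.2 (by omega)))

theorem exists_equiv_strictMono {P α : Type} [Fintype P] [LinearOrder α] {n : ℕ}
    (hcard : Fintype.card P = n) {k : P → α} (hk : Function.Injective k) :
    ∃ e : Fin n ≃ P, StrictMono (k ∘ e) := by
  let _ : LinearOrder P := LinearOrder.lift' k hk
  exact ⟨(Fintype.orderIsoFinOfCardEq P hcard).toEquiv,
    fun i j h => (Fintype.orderIsoFinOfCardEq P hcard).strictMono h⟩

theorem equiv_eq_of_strictMono {P α : Type} [LinearOrder α] {n : ℕ} {k : P → α}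
    (hk : Function.Injective k) {e f : Fin n ≃ P} (he : StrictMono (k ∘ e))
    (hf : StrictMono (k ∘ f)) : e = f := by
  have h : k ∘ e = k ∘ f := (StrictMono.range_inj he hf).1 (by
    rw [e.surjective.range_comp, f.surjective.range_comp])
  exact Equiv.ext fun i => hk (congrFun h i)

theorem finite_bounded_maps {P : Type} [Finite P] (x : ℤ) (Q : (P → ℤ) → Prop) :
    Finite {φ : P → ℤ // (∀ v, 1 ≤ φ v ∧ φ v ≤ x) ∧ Q φ} := by
  have h : (Set.pi Set.univ fun _ : P => Set.Icc (1 : ℤ) x).Finite :=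
    Set.Finite.pi fun _ => Set.finite_Icc _ _
  exact (h.subset fun φ hφ v _ => hφ.1 v : {φ : P → ℤ | (∀ v, 1 ≤ φ v ∧ φ v ≤ x) ∧ Q φ}.Finite)

theorem linear_extension_of_strictMono {P : Type} [PartialOrder P] {n : ℕ} {τ : P → ℕ}
    (hnat : ∀ v w : P, v < w → τ v < τ w) {φ : P → ℤ} (hφ : ∀ v w : P, v ≤ w → φ v ≤ φ w)
    {e : Fin n ≃ P} (he : StrictMono (lexKey τ φ ∘ e)) (i j : Fin n) (hij : e i ≤ e j) :
    i ≤ j := by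
  refine he.le_iff_le.1 ?_
  rcases hij.eq_or_lt with h | h
  · simp [h]
  · have := hφ _ _ hij
    have := hnat _ _ h
    simp only [Function.comp, lexKey, Prod.Lex.toLex_le_toLex]
    omega

theorem map_le_of_strictMono {P : Type} [PartialOrder P] {n : ℕ} {τ : P → ℕ} {φ : P → ℤ}
    {e : Fin n ≃ P} (hlin : ∀ i j : Fin n, e i ≤ e j → i ≤ j)
    (he : StrictMono (lexKey τ φ ∘ e)) (v w : P) (hvw : v ≤ w) : φ v ≤ φ w := by
  have h := he.monotone (hlin (e.symm v) (e.symm w) (by simpa using hvw))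
  exact le_of_lexKey_le (by simpa using h)

open scoped Classical in
/-- Let `(P,C)` be a bicolored poset with `n` elements and let
`τ : P → {1,…,n}` be a natural labeling.  Then for all integers `x ≥ 1`, `y ≥ 0`,
`Ω_{P,C}(x,y) = Σ_L Ω_{τ_L}(x,y)`, the sum over all linear extensions `L` of `P`
(encoded as equivalences `e : Fin n ≃ P` with `e i ≤_P e j → i ≤ j`). -/
theorem stmt_10 (P : Type) [Fintype P] [PartialOrder P] (n : ℕ)
    (hcard : Fintype.card P = n) (C : Finset P)
    (τ : P → ℕ) (hτ1 : ∀ v, τ v ∈ Finset.Icc 1 n) (hτ2 : Function.Injective τ)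
    (hnat : ∀ v w : P, v < w → τ v < τ w)
    (x y : ℤ) (hx : 1 ≤ x) (hy : 0 ≤ y) :
    Nat.card {φ : P → ℤ //
        (∀ v, 1 ≤ φ v ∧ φ v ≤ x) ∧
        (∀ v w : P, v ≤ w → φ v ≤ φ w) ∧
        (∀ c ∈ C, y ≤ φ c)}
      = ∑ e ∈ Finset.univ.filter
            (fun e : Fin n ≃ P => ∀ i j : Fin n, e i ≤ e j → i ≤ j),
          typeMapsWeak n τ e C x y := by
  rw [← Finset.sum_coe_sort]
  simp only [typeMapsWeak, word_conditions_iff_strictMono hτ2]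
  have hfin := fun Q => finite_bounded_maps (P := P) x Q
  rw [← Nat.card_sigma]
  refine (Nat.card_congr (Equiv.ofBijective (fun p => ⟨p.2.1, p.2.2.1,
    map_le_of_strictMono (Finset.mem_filter.1 p.1.2).2 p.2.2.2.1, p.2.2.2.2⟩) ⟨?_, ?_⟩)).symm
  · rintro ⟨⟨e, _⟩, φ, hφ⟩ ⟨⟨f, _⟩, ψ, hψ⟩ h
    obtain rfl : φ = ψ := congrArg Subtype.val h
    obtain rfl := equiv_eq_of_strictMono (lexKey_injective hτ2 φ) hφ.2.1 hψ.2.1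
    rfl
  · rintro ⟨φ, hb, hm, hc⟩
    obtain ⟨e, he⟩ := exists_equiv_strictMono hcard (lexKey_injective hτ2 φ)
    exact ⟨⟨⟨e, Finset.mem_filter.2
      ⟨Finset.mem_univ _, linear_extension_of_strictMono hnat hm he⟩⟩, φ, hb, he, hc⟩, rfl⟩
end

section
/- Let G = (V,E) be a finite simple graph. For all integers x ≥ 1 and y ≥ 0, χ_G(x,y) = Σ_π Σ_σ N°_{π,σ}(x,y), where the outer sum is over all partitions π of V each of whose blocks induces a connected subgraph of G, the inner sum is over all acyclic orientations σ of the flat H_π, and N°_{π,σ}(x,y) is the number of maps c : V(H_π) → {1,…,x} such that c(B) < c(B′) whenever σ orients an edge from block B to block B′, and c(B) > y for every B ∈ C(H_π). -/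
/-- A finite type is counted by the fibres of a map into a finset. -/
theorem card_subtype_eq_sum_fiber {α ι : Type*} {p : α → Prop} (hfin : Finite {a // p a})
    (t : Finset ι) (f : α → ι) (hf : ∀ a, p a → f a ∈ t) :
    Nat.card {a // p a} = ∑ i ∈ t, Nat.card {a // p a ∧ f a = i} := by
  have hfib (i : t) : Finite {a // p a ∧ f a = i.1} :=
    Finite.of_injective (fun a => (⟨a.1, a.2.1⟩ : {a // p a}))
      fun a b h => Subtype.ext (Subtype.mk.inj h)
  rw [← Finset.sum_coe_sort t (fun i => Nat.card {a // p a ∧ f a = i}), ← Nat.card_sigma]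
  exact Nat.card_congr
    { toFun := fun a => ⟨⟨f a.1, hf a.1 a.2⟩, a.1, a.2, rfl⟩
      invFun := fun s => ⟨s.2.1, s.2.2.1⟩
      left_inv := fun _ => rfl
      right_inv := by
        rintro ⟨⟨i, hi⟩, a, ha, h⟩
        dsimp only at h
        subst h
        rfl }

/-- There are finitely many integer functions with values in a bounded interval. -/
theorem finite_subtype_of_bounded {ι : Type*} [Finite ι] {p : (ι → ℤ) → Prop} (x : ℤ)
    (hp : ∀ c, p c → ∀ i, 1 ≤ c i ∧ c i ≤ x) : Finite {c // p c} :=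
  ((Set.Finite.pi' fun _ : ι => Set.finite_Icc (1 : ℤ) x).subset
    fun c hc i => hp c hc i : {c | p c}.Finite)

namespace SimpleGraph

variable {V : Type*} (G : SimpleGraph V)

/-- Colorings with colors in `{1, …, x}` whose monochromatic edges have color above `y`. -/
def IsBivariateColoring (x y : ℤ) (c : V → ℤ) : Prop :=
  (∀ v, 1 ≤ c v ∧ c v ≤ x) ∧ ∀ v w : V, G.Adj v w → (c v ≠ c w ∨ (c v = c w ∧ y < c v))

/-- Partitions of the vertex set into nonempty blocks inducing connected subgraphs. -/
def IsConnectedPartition (P : Finset (Finset V)) : Prop :=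
  (∀ B ∈ P, B.Nonempty) ∧ (∀ v : V, ∃! B, B ∈ P ∧ v ∈ B) ∧
    ∀ B ∈ P, (G.induce (B : Set V)).Connected

/-- Adjacency of blocks in a flat. -/
def FlatAdj (B B' : Finset V) : Prop :=
  B ≠ B' ∧ ∃ v ∈ B, ∃ w ∈ B', G.Adj v w

/-- Colorings of a flat: adjacent blocks get distinct colors, and contracted blocks get
colors above `y`. -/
def IsFlatColoring (P : Finset (Finset V)) (x y : ℤ) (d : {B // B ∈ P} → ℤ) : Prop :=
  (∀ B, 1 ≤ d B ∧ d B ≤ x) ∧ (∀ B B' : {B // B ∈ P}, G.FlatAdj B.1 B'.1 → d B ≠ d B') ∧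
    ∀ B : {B // B ∈ P}, 2 ≤ B.1.card → y < d B

/-- Acyclic orientations of a flat. -/
def IsFlatOrientation (P : Finset (Finset V)) (r : Finset V → Finset V → Bool) : Prop :=
  (∀ B B' : Finset V, r B B' = true → B ∈ P ∧ B' ∈ P ∧ G.FlatAdj B B') ∧
    (∀ B ∈ P, ∀ B' ∈ P, G.FlatAdj B B' →
      ((r B B' = true ∨ r B' B = true) ∧ ¬(r B B' = true ∧ r B' B = true))) ∧
    ∀ B : Finset V, ¬ Relation.TransGen (fun A A' => r A A' = true) B B

/-- The spanning subgraph of monochromatic edges. -/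
def monochromatic {α : Type*} (c : V → α) : SimpleGraph V where
  Adj v w := G.Adj v w ∧ c v = c w
  symm := ⟨fun _ _ h => ⟨h.1.symm, h.2.symm⟩⟩
  loopless := ⟨fun _ h => G.loopless.irrefl _ h.1⟩

variable {G}

theorem FlatAdj.symm {B B' : Finset V} (h : G.FlatAdj B B') : G.FlatAdj B' B :=
  let ⟨hne, v, hv, w, hw, hvw⟩ := h
  ⟨hne.symm, w, hw, v, hv, hvw.symm⟩

theorem Reachable.eq_of_monochromatic {α : Type*} {c : V → α} {v w : V}
    (h : (G.monochromatic c).Reachable v w) : c v = c w := by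
  obtain ⟨p⟩ := h
  induction p with
  | nil => rfl
  | cons hadj _ ih => exact hadj.2.trans ih

theorem IsConnectedPartition.eq_of_mem {P : Finset (Finset V)} (hP : G.IsConnectedPartition P)
    {B B' : Finset V} (hB : B ∈ P) (hB' : B' ∈ P) {v : V} (hv : v ∈ B) (hv' : v ∈ B') :
    B = B' :=
  (hP.2.1 v).unique ⟨hB, hv⟩ ⟨hB', hv'⟩

theorem IsConnectedPartition.reachable_monochromatic_iff {P : Finset (Finset V)}
    (hP : G.IsConnectedPartition P) {α : Type*} {c : V → α}
    (hconst : ∀ B ∈ P, ∀ v ∈ B, ∀ w ∈ B, c v = c w)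
    (hne : ∀ B ∈ P, ∀ B' ∈ P, B ≠ B' → ∀ v ∈ B, ∀ w ∈ B', G.Adj v w → c v ≠ c w)
    {B : Finset V} (hB : B ∈ P) {v w : V} (hv : v ∈ B) :
    (G.monochromatic c).Reachable v w ↔ w ∈ B := by
  constructor
  · rintro ⟨p⟩
    induction p with
    | nil => exact hv
    | @cons u u' _ hadj _ ih =>
      obtain ⟨B', ⟨hB', hu'⟩, -⟩ := hP.2.1 u'
      apply ih
      by_contra hn
      exact hne B hB B' hB' (fun h => hn (h ▸ hu')) u hv u' hu' hadj.1 hadj.2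
  · intro hw
    let φ : G.induce (B : Set V) →g G.monochromatic c :=
      ⟨Subtype.val, fun {a b} h => ⟨h, hconst B hB a a.2 b b.2⟩⟩
    exact ((hP.2.2 B hB).preconnected ⟨v, hv⟩ ⟨w, hw⟩).map φ

section Components

open scoped Classical

variable [Fintype V]

variable (G) in
/-- The vertex sets of the connected components of the monochromatic subgraph. -/
noncomputable def monochromaticBlocks {α : Type*} (c : V → α) : Finset (Finset V) :=
  Finset.univ.image fun v => Finset.univ.filter fun w => (G.monochromatic c).Reachable v w

theorem mem_monochromaticBlocks {α : Type*} {c : V → α} {B : Finset V} :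
    B ∈ G.monochromaticBlocks c ↔
      ∃ v, B = Finset.univ.filter fun w => (G.monochromatic c).Reachable v w := by
  simp [monochromaticBlocks, eq_comm]

theorem mem_iff_reachable_of_mem_monochromaticBlocks {α : Type*} {c : V → α} {B : Finset V}
    (hB : B ∈ G.monochromaticBlocks c) {v w : V} (hv : v ∈ B) :
    w ∈ B ↔ (G.monochromatic c).Reachable v w := by
  obtain ⟨u, rfl⟩ := mem_monochromaticBlocks.1 hB
  simp only [Finset.mem_filter, Finset.mem_univ, true_and] at hv ⊢
  exact ⟨fun h => hv.symm.trans h, fun h => hv.trans h⟩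

theorem isConnectedPartition_monochromaticBlocks {α : Type*} (c : V → α) :
    G.IsConnectedPartition (G.monochromaticBlocks c) := by
  refine ⟨fun B hB => ?_, fun v => ?_, fun B hB => ?_⟩
  · obtain ⟨u, rfl⟩ := mem_monochromaticBlocks.1 hB
    exact ⟨u, by simp⟩
  · refine ⟨_, ⟨mem_monochromaticBlocks.2 ⟨v, rfl⟩, by simp⟩, fun B hB => ?_⟩
    ext w
    simpa using mem_iff_reachable_of_mem_monochromaticBlocks hB.1 hB.2
  · have hlift : ∀ {v w : V} (p : (G.monochromatic c).Walk v w) (hv : v ∈ B) (hw : w ∈ B),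
        (G.induce (B : Set V)).Reachable ⟨v, hv⟩ ⟨w, hw⟩ := by
      intro v w p
      induction p with
      | nil => exact fun _ _ => Reachable.refl _
      | @cons u u' _ hadj _ ih =>
        intro hv hw
        have hu' : u' ∈ B :=
          (mem_iff_reachable_of_mem_monochromaticBlocks hB hv).2 hadj.reachable
        have hstep : (G.induce (B : Set V)).Adj ⟨u, hv⟩ ⟨u', hu'⟩ := hadj.1
        exact hstep.reachable.trans (ih hu' hw)
    obtain ⟨u, rfl⟩ := mem_monochromaticBlocks.1 hB
    have : Nonempty ((Finset.univ.filter fun w => (G.monochromatic c).Reachable u w :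
        Finset V) : Set V) := ⟨⟨u, by simp⟩⟩
    refine ⟨fun v w => ?_⟩
    obtain ⟨p⟩ := (mem_iff_reachable_of_mem_monochromaticBlocks hB v.2).1 w.2
    exact hlift p v.2 w.2

theorem IsConnectedPartition.monochromaticBlocks_eq {P : Finset (Finset V)}
    (hP : G.IsConnectedPartition P) {α : Type*} {c : V → α}
    (hconst : ∀ B ∈ P, ∀ v ∈ B, ∀ w ∈ B, c v = c w)
    (hne : ∀ B ∈ P, ∀ B' ∈ P, B ≠ B' → ∀ v ∈ B, ∀ w ∈ B', G.Adj v w → c v ≠ c w) :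
    G.monochromaticBlocks c = P := by
  have hblock {B : Finset V} (hB : B ∈ P) {v : V} (hv : v ∈ B) :
      B = Finset.univ.filter fun w => (G.monochromatic c).Reachable v w := by
    ext w
    simpa using (hP.reachable_monochromatic_iff hconst hne hB hv).symm
  ext B
  rw [mem_monochromaticBlocks]
  constructor
  · rintro ⟨v, rfl⟩
    obtain ⟨B, ⟨hB, hv⟩, -⟩ := hP.2.1 v
    exact hblock hB hv ▸ hB
  · intro hB
    obtain ⟨v, hv⟩ := hP.1 B hB
    exact ⟨v, hblock hB hv⟩

/-- Colorings with prescribed monochromatic components correspond to colorings of the flat. -/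
theorem IsConnectedPartition.card_fiber {P : Finset (Finset V)}
    (hP : G.IsConnectedPartition P) (x y : ℤ) :
    Nat.card {c // G.IsBivariateColoring x y c ∧ G.monochromaticBlocks c = P} =
      Nat.card {d // G.IsFlatColoring P x y d} := by
  choose b hb _ using hP.2.1
  have hb_eq {B : Finset V} (hB : B ∈ P) {v : V} (hv : v ∈ B) :
      (⟨b v, (hb v).1⟩ : {B // B ∈ P}) = ⟨B, hB⟩ :=
    Subtype.ext (hP.eq_of_mem (hb v).1 hB (hb v).2 hv)
  choose e he using fun B : {B // B ∈ P} => hP.1 B.1 B.2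
  have hpull (d) (hd : G.IsFlatColoring P x y d) :
      G.IsBivariateColoring x y (fun v => d ⟨b v, (hb v).1⟩) ∧
        G.monochromaticBlocks (fun v => d ⟨b v, (hb v).1⟩) = P := by
    refine ⟨⟨fun v => hd.1 _, fun v w hvw => ?_⟩, hP.monochromaticBlocks_eq ?_ ?_⟩
    · by_cases h : b v = b w
      · refine Or.inr ⟨by simp only [h], hd.2.2 _ ?_⟩
        exact Finset.one_lt_card.2 ⟨v, (hb v).2, w, by simpa only [h] using (hb w).2, hvw.ne⟩
      · exact Or.inl (hd.2.1 _ _ ⟨h, v, (hb v).2, w, (hb w).2, hvw⟩)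
    · intro B hB v hv w hw
      simp only [hb_eq hB hv, hb_eq hB hw]
    · intro B hB B' hB' hne v hv w hw hvw
      simp only [hb_eq hB hv, hb_eq hB' hw]
      exact hd.2.1 _ _ ⟨hne, v, hv, w, hw, hvw⟩
  have hconst {c : V → ℤ} (h : G.monochromaticBlocks c = P) {B : Finset V} (hB : B ∈ P)
      {v w : V} (hv : v ∈ B) (hw : w ∈ B) : c v = c w := by
    subst h
    exact ((mem_iff_reachable_of_mem_monochromaticBlocks hB hv).1 hw).eq_of_monochromatic
  have hpush (c) (hc : G.IsBivariateColoring x y c ∧ G.monochromaticBlocks c = P) :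
      G.IsFlatColoring P x y (fun B => c (e B)) := by
    obtain ⟨⟨hbd, hadj⟩, hcP⟩ := hc
    refine ⟨fun B => hbd _, ?_, ?_⟩
    · rintro B B' ⟨hne, v, hv, w, hw, hvw⟩ heq
      have hvw' : c v = c w :=
        (hconst hcP B.2 hv (he B)).trans (heq.trans (hconst hcP B'.2 (he B') hw))
      have hmem : B.1 ∈ G.monochromaticBlocks c := hcP.symm ▸ B.2
      have hreach : (G.monochromatic c).Adj v w := ⟨hvw, hvw'⟩
      exact hne (hP.eq_of_mem B.2 B'.2
        ((mem_iff_reachable_of_mem_monochromaticBlocks hmem hv).2 hreach.reachable) hw)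
    · intro B hB
      have hnt : Nontrivial (B.1 : Set V) :=
        (Finset.one_lt_card_iff_nontrivial.1 hB).coe_sort
      obtain ⟨w, hw⟩ := (hP.2.2 B.1 B.2).preconnected.exists_adj_of_nontrivial ⟨e B, he B⟩
      have hew : c (e B) = c w.1 := hconst hcP B.2 (he B) w.2
      exact ((hadj _ _ hw).resolve_left (not_not.2 hew)).2
  exact Nat.card_congr
    { toFun := fun c => ⟨_, hpush c.1 c.2⟩
      invFun := fun d => ⟨_, hpull d.1 d.2⟩
      left_inv := fun c => Subtype.ext <| funext fun v =>
        hconst c.2.2 (hb v).1 (he ⟨b v, (hb v).1⟩) (hb v).2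
      right_inv := fun d => Subtype.ext <| funext fun B => congrArg d.1 (hb_eq B.2 (he B)) }

end Components

section Orientation

open scoped Classical

variable (G) in
/-- The orientation of a flat along increasing colors. -/
noncomputable def flatOrientation (P : Finset (Finset V)) (d : {B // B ∈ P} → ℤ)
    (B B' : Finset V) : Bool :=
  decide (∃ (hB : B ∈ P) (hB' : B' ∈ P), G.FlatAdj B B' ∧ d ⟨B, hB⟩ < d ⟨B', hB'⟩)

theorem flatOrientation_eq_true {P : Finset (Finset V)} {d : {B // B ∈ P} → ℤ}
    {B B' : Finset V} : G.flatOrientation P d B B' = true ↔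
      ∃ (hB : B ∈ P) (hB' : B' ∈ P), G.FlatAdj B B' ∧ d ⟨B, hB⟩ < d ⟨B', hB'⟩ := by
  simp [flatOrientation]

theorem IsFlatColoring.isFlatOrientation {P : Finset (Finset V)} {x y : ℤ}
    {d : {B // B ∈ P} → ℤ} (hd : G.IsFlatColoring P x y d) :
    G.IsFlatOrientation P (G.flatOrientation P d) := by
  simp only [IsFlatOrientation, flatOrientation_eq_true]
  refine ⟨fun B B' ⟨hB, hB', h, _⟩ => ⟨hB, hB', h⟩, fun B hB B' hB' h => ⟨?_, ?_⟩, ?_⟩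
  · exact (lt_or_gt_of_ne (hd.2.1 ⟨B, hB⟩ ⟨B', hB'⟩ h)).imp
      (fun hlt => ⟨hB, hB', h, hlt⟩) (fun hlt => ⟨hB', hB, h.symm, hlt⟩)
  · rintro ⟨⟨_, _, _, h1⟩, ⟨_, _, _, h2⟩⟩
    exact lt_asymm h1 h2
  · intro B hcycle
    have hlt : ∀ {B'}, Relation.TransGen (fun A A' => ∃ (hA : A ∈ P) (hA' : A' ∈ P),
        G.FlatAdj A A' ∧ d ⟨A, hA⟩ < d ⟨A', hA'⟩) B B' →
        ∃ (hB : B ∈ P) (hB' : B' ∈ P), d ⟨B, hB⟩ < d ⟨B', hB'⟩ := by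
      intro B' h
      induction h with
      | single h => exact ⟨h.1, h.2.1, h.2.2.2⟩
      | tail _ h ih => exact ⟨ih.1, h.2.1, ih.2.2.trans h.2.2.2⟩
    exact lt_irrefl _ (hlt hcycle).2.2

/-- The flat colorings inducing a given acyclic orientation are the maps increasing along it. -/
theorem IsFlatOrientation.isFlatColoring_and_eq_iff {P : Finset (Finset V)}
    {r : Finset V → Finset V → Bool} (hr : G.IsFlatOrientation P r) {x y : ℤ}
    {d : {B // B ∈ P} → ℤ} :
    G.IsFlatColoring P x y d ∧ G.flatOrientation P d = r ↔
      (∀ B, 1 ≤ d B ∧ d B ≤ x) ∧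
      (∀ B B' : {B : Finset V // B ∈ P}, r B.1 B'.1 = true → d B < d B') ∧
      (∀ B : {B : Finset V // B ∈ P}, 2 ≤ B.1.card → y < d B) := by
  constructor
  · rintro ⟨hd, rfl⟩
    exact ⟨hd.1, fun B B' h => (flatOrientation_eq_true.1 h).2.2.2, hd.2.2⟩
  · rintro ⟨hbd, hlt, hy⟩
    refine ⟨⟨hbd, fun B B' h => ?_, hy⟩, ?_⟩
    · exact (hr.2.1 B.1 B.2 B'.1 B'.2 h).1.elim (fun h => (hlt B B' h).ne)
        (fun h => (hlt B' B h).ne')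
    · funext B B'
      rw [Bool.eq_iff_iff, flatOrientation_eq_true]
      constructor
      · rintro ⟨hB, hB', h, hd⟩
        exact (hr.2.1 B hB B' hB' h).1.resolve_right
          fun h' => lt_asymm hd (hlt ⟨B', hB'⟩ ⟨B, hB⟩ h')
      · intro h
        obtain ⟨hB, hB', hadj⟩ := hr.1 B B' h
        exact ⟨hB, hB', hadj, hlt ⟨B, hB⟩ ⟨B', hB'⟩ h⟩

end Orientation

end SimpleGraph


open scoped Classical in
/-- For a finite simple graph `G` and integers `x ≥ 1`, `y ≥ 0`,
`χ_G(x,y) = Σ_π Σ_σ N°_{π,σ}(x,y)`, where `π` ranges over partitions of `V` all of whose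
blocks induce connected subgraphs of `G`, `σ` ranges over acyclic orientations of the flat
`H_π`, and `N°_{π,σ}(x,y)` counts maps `c` on the blocks with `1 ≤ c ≤ x`, `c(B) < c(B')`
whenever `σ` orients an edge from `B` to `B'`, and `c(B) > y` for blocks of size `≥ 2`. -/
theorem stmt_11 (V : Type) [Fintype V] (G : SimpleGraph V)
    (x y : ℤ) (hx : 1 ≤ x) (hy : 0 ≤ y) :
    Nat.card {c : V → ℤ //
        (∀ v, 1 ≤ c v ∧ c v ≤ x) ∧
        (∀ v w : V, G.Adj v w → (c v ≠ c w ∨ (c v = c w ∧ y < c v)))}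
      = ∑ P ∈ Finset.univ.filter (fun P : Finset (Finset V) =>
            (∀ B ∈ P, B.Nonempty) ∧
            (∀ v : V, ∃! B, B ∈ P ∧ v ∈ B) ∧
            (∀ B ∈ P, (G.induce (B : Set V)).Connected)),
          ∑ r ∈ Finset.univ.filter (fun r : Finset V → Finset V → Bool =>
              (∀ B B' : Finset V, r B B' = true →
                B ∈ P ∧ B' ∈ P ∧ B ≠ B' ∧ ∃ v ∈ B, ∃ w ∈ B', G.Adj v w) ∧
              (∀ B ∈ P, ∀ B' ∈ P, (B ≠ B' ∧ ∃ v ∈ B, ∃ w ∈ B', G.Adj v w) →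
                ((r B B' = true ∨ r B' B = true) ∧ ¬(r B B' = true ∧ r B' B = true))) ∧
              (∀ B : Finset V, ¬ Relation.TransGen (fun A A' => r A A' = true) B B)),
            Nat.card {c : {B : Finset V // B ∈ P} → ℤ //
              (∀ B, 1 ≤ c B ∧ c B ≤ x) ∧
              (∀ B B' : {B : Finset V // B ∈ P}, r B.1 B'.1 = true → c B < c B') ∧
              (∀ B : {B : Finset V // B ∈ P}, 2 ≤ B.1.card → y < c B)} := by
  refine (card_subtype_eq_sum_fiber (finite_subtype_of_bounded x fun c hc => hc.1) _
    G.monochromaticBlocks ?_).trans (Finset.sum_congr rfl fun P hP => ?_)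
  · exact fun c _ => Finset.mem_filter.2
      ⟨Finset.mem_univ _, SimpleGraph.isConnectedPartition_monochromaticBlocks c⟩
  have hP : G.IsConnectedPartition P := (Finset.mem_filter.1 hP).2
  refine (hP.card_fiber x y).trans <|
    (card_subtype_eq_sum_fiber (finite_subtype_of_bounded x fun d hd => hd.1) _
      (G.flatOrientation P) ?_).trans (Finset.sum_congr rfl fun r hr => ?_)
  · exact fun d hd => Finset.mem_filter.2 ⟨Finset.mem_univ _, hd.isFlatOrientation⟩
  have hr : G.IsFlatOrientation P r := (Finset.mem_filter.1 hr).2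
  exact Nat.card_congr (Equiv.subtypeEquivRight fun d => hr.isFlatColoring_and_eq_iff)
end

section
/- Let G = (V,E) be a finite simple graph and let p ∈ ℚ[X,Y] be a polynomial such that p(x,y) = χ_G(x,y) for all integers x and y with x ≥ 1 and 0 ≤ y ≤ x. Then for all integers x and y with x ≥ 1 and 0 ≤ y ≤ x−1, p(−x,−y) = Σ_π (−1)^{|π|} · m_π(x,y), where the sum is over all partitions π of V each of whose blocks induces a connected subgraph of G, |π| denotes the number of blocks of π, and m_π(x,y) is the number of pairs (σ, c) consisting of an acyclic orientation σ of the flat H_π and a coloring c : V(H_π) → {1,…,x} such that c(B) ≤ c(B′) whenever σ orients an edge from block B to block B′, and c(B) > y for every B ∈ C(H_π). -/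
section Binomial
open Polynomial

theorem exists_polynomial_eval_eq_choose_s12 (k : ℕ) :
    ∃ q : ℚ[X], ∀ z : ℚ, q.eval z = Ring.choose z k := by
  refine ⟨C ((k.factorial : ℚ)⁻¹) * (descPochhammer ℚ k), fun z => ?_⟩
  have h := Ring.descPochhammer_eq_factorial_smul_choose z k
  have h2 : (descPochhammer ℤ k).smeval z = (descPochhammer ℚ k).eval z := by
    rw [← descPochhammer_map (Int.castRingHom ℚ), Polynomial.eval_map,
      ← Polynomial.eval₂_smulOneHom_eq_smeval]
    congr 1
    exact Subsingleton.elim _ _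
  rw [eval_mul, eval_C, ← h2, h, nsmul_eq_mul, inv_mul_cancel_left₀]
  exact_mod_cast k.factorial_ne_zero

variable {R : Type*} [Ring R] [Algebra ℚ R]

/-- The truncation of the binomial series `(1 + N) ^ z`. -/
noncomputable def binomSum (N : R) (m : ℕ) (z : ℚ) : R :=
  ∑ k ∈ Finset.range m, Ring.choose z k • N ^ k

theorem binomSum_zero (N : R) (m : ℕ) : binomSum N (m + 1) 0 = 1 := by
  simp [binomSum, Finset.sum_range_succ']

theorem binomSum_add_one {N : R} {m : ℕ} (hN : N ^ (m + 1) = 0) (z : ℚ) :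
    binomSum N (m + 1) (z + 1) = binomSum N (m + 1) z * (1 + N) := by
  have h1 : binomSum N (m + 1) (z + 1) =
      ∑ k ∈ Finset.range m, (Ring.choose z k • N ^ (k + 1)) +
        binomSum N (m + 1) z := by
    rw [binomSum, binomSum, Finset.sum_range_succ', Finset.sum_range_succ' _ m, ← add_assoc,
      ← Finset.sum_add_distrib]
    simp [Ring.choose_succ_succ, add_smul]
  rw [h1, mul_add, mul_one, add_comm]
  congr 1
  rw [binomSum, Finset.sum_mul, Finset.sum_range_succ, smul_mul_assoc, ← pow_succ, hN, smul_zero,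
    add_zero]
  simp [pow_succ]

theorem binomSum_natCast {N : R} {m : ℕ} (hN : N ^ (m + 1) = 0) (n : ℕ) :
    binomSum N (m + 1) n = (1 + N) ^ n := by
  induction n with
  | zero => simpa using binomSum_zero N m
  | succ n ih => rw [Nat.cast_succ, binomSum_add_one hN, ih, pow_succ]

theorem binomSum_neg_natCast {N v : R} {m : ℕ} (hN : N ^ (m + 1) = 0) (hv : (1 + N) * v = 1)
    (n : ℕ) : binomSum N (m + 1) (-n) = v ^ n := by
  induction n with
  | zero => simpa using binomSum_zero N m
  | succ n ih =>
    have h := binomSum_add_one hN (-((n + 1 : ℕ) : ℚ))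
    rw [show (-((n + 1 : ℕ) : ℚ)) + 1 = -n by push_cast; ring, ih] at h
    rw [pow_succ, h, mul_assoc, hv, mul_one]

theorem exists_polynomial_eval_eq_binomSum_mul (N N' : R) (m : ℕ) (φ : R →ₗ[ℚ] ℚ) (a b : ℚ) :
    ∃ q : ℚ[X], ∀ t : ℚ,
      q.eval t = φ (binomSum N m (a * t) * binomSum N' m (b * t)) := by
  choose ch hch using exists_polynomial_eval_eq_choose_s12
  refine ⟨∑ k ∈ Finset.range m, ∑ l ∈ Finset.range m,
    C (φ (N ^ k * N' ^ l)) * ((ch k).comp (C a * X) * (ch l).comp (C b * X)), fun t => ?_⟩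
  simp only [binomSum, Finset.sum_mul_sum, map_sum, eval_finsetSum, smul_mul_smul_comm, map_smul,
    eval_mul, eval_C, eval_comp, eval_X, hch, smul_eq_mul]
  exact Finset.sum_congr rfl fun k _ => Finset.sum_congr rfl fun l _ => mul_comm _ _

end Binomial

section SubsetConvolution

variable {W : Type*} [DecidableEq W]

/-- Convolution of set functions over ordered splittings of a set into two disjoint parts. -/
def subsetConv (f : Finset W → ℚ) : Module.End ℚ (Finset W → ℚ) where
  toFun g T := ∑ S ∈ T.powerset, f S * g (T \ S)
  map_add' g h := by
    ext T
    simp [mul_add, Finset.sum_add_distrib]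
  map_smul' a g := by
    ext T
    simp [Finset.mul_sum, mul_left_comm]

theorem subsetConv_apply (f g : Finset W → ℚ) (T : Finset W) :
    subsetConv f g T = ∑ S ∈ T.powerset, f S * g (T \ S) := rfl

theorem subsetConv_mul (f g : Finset W → ℚ) :
    subsetConv f * subsetConv g = subsetConv (subsetConv f g) := by
  refine LinearMap.ext fun h => funext fun T => ?_
  simp only [Module.End.mul_apply, subsetConv_apply, Finset.mul_sum, Finset.sum_mul]
  rw [Finset.sum_sigma', Finset.sum_sigma']
  refine Finset.sum_bij' (fun p _ => ⟨p.1 ∪ p.2, p.1⟩) (fun p _ => ⟨p.2, p.1 \ p.2⟩) ?_ ?_ ?_ ?_ ?_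
  · rintro ⟨S, R⟩ h
    simp only [Finset.mem_sigma, Finset.mem_powerset] at h ⊢
    grind
  · rintro ⟨S, R⟩ h
    simp only [Finset.mem_sigma, Finset.mem_powerset] at h ⊢
    grind
  · rintro ⟨S, R⟩ h
    simp only [Finset.mem_sigma, Finset.mem_powerset] at h
    have : (S ∪ R) \ S = R := by grind
    simp [this]
  · rintro ⟨S, R⟩ h
    simp only [Finset.mem_sigma, Finset.mem_powerset] at h
    have : R ∪ S \ R = S := by grind
    simp [this]
  · rintro ⟨S, R⟩ h
    simp only [Finset.mem_sigma, Finset.mem_powerset] at h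
    have h1 : (S ∪ R) \ S = R := by grind
    have h2 : T \ (S ∪ R) = (T \ S) \ R := by grind
    simp [h1, h2, mul_assoc]

/-- The identity for convolution: the indicator of the empty set. -/
def emptyIndicator (T : Finset W) : ℚ := if T = ∅ then 1 else 0

theorem subsetConv_emptyIndicator : subsetConv (emptyIndicator (W := W)) = 1 := by
  refine LinearMap.ext fun h => funext fun T => ?_
  simp [subsetConv_apply, emptyIndicator]

theorem subsetConv_sub_one_pow_apply {f : Finset W → ℚ} (hf : f ∅ = 1) (k : ℕ)
    (g : Finset W → ℚ) (T : Finset W) (hT : T.card < k) : ((subsetConv f - 1) ^ k) g T = 0 := by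
  induction k generalizing T with
  | zero => simp at hT
  | succ k ih =>
    rw [pow_succ', Module.End.mul_apply, LinearMap.sub_apply, Pi.sub_apply, Module.End.one_apply,
      subsetConv_apply, Finset.sum_eq_single ∅]
    · simp [hf]
    · intro S hS hne
      rw [Finset.mem_powerset] at hS
      rw [ih, mul_zero]
      have := Finset.card_sdiff_add_card_eq_card hS
      have := Finset.card_pos.2 (Finset.nonempty_iff_ne_empty.2 hne)
      omega
    · simp

theorem subsetConv_sub_one_pow [Fintype W] {f : Finset W → ℚ} (hf : f ∅ = 1) :
    (subsetConv f - 1) ^ (Fintype.card W + 1) = 0 := by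
  refine LinearMap.ext fun g => funext fun T => ?_
  exact subsetConv_sub_one_pow_apply hf _ g T (Nat.lt_succ_of_le (Finset.card_le_univ T))

/-- Maps sending `T` to colors `0, …, n - 1` and everything else to `0`. -/
def extColorings [Fintype W] (T : Finset W) (n : ℕ) : Finset (W → ℕ) :=
  Fintype.piFinset fun v => if v ∈ T then Finset.range n else {0}

theorem mem_extColorings [Fintype W] {T : Finset W} {n : ℕ} {c : W → ℕ} :
    c ∈ extColorings T n ↔ (∀ v ∈ T, c v < n) ∧ ∀ v ∉ T, c v = 0 := by
  rw [extColorings, Fintype.mem_piFinset]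
  constructor
  · intro h
    refine ⟨fun v hv => ?_, fun v hv => ?_⟩ <;> simpa [hv] using h v
  · rintro ⟨h1, h2⟩ v
    by_cases hv : v ∈ T
    · simpa [hv] using h1 v hv
    · simpa [hv] using h2 v hv

/-- Iterated convolution of the set functions `f 0, …, f (n - 1)`. -/
def iterConv (f : ℕ → Finset W → ℚ) : ℕ → Finset W → ℚ
  | 0 => emptyIndicator
  | n + 1 => subsetConv (f n) (iterConv f n)

theorem sum_extColorings_prod [Fintype W] (f : ℕ → Finset W → ℚ) (n : ℕ) (T : Finset W) :
    ∑ c ∈ extColorings T n, ∏ i ∈ Finset.range n, f i (T.filter (c · = i)) = iterConv f n T := by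
  induction n generalizing T with
  | zero =>
    rcases T.eq_empty_or_nonempty with rfl | ⟨v, hv⟩
    · have : extColorings (∅ : Finset W) 0 = {0} := by
        ext c
        simp [mem_extColorings, funext_iff]
      simp [this, iterConv, emptyIndicator]
    · have : extColorings T 0 = ∅ := by
        ext c
        simp only [mem_extColorings, Finset.notMem_empty, iff_false]
        exact fun h => absurd (h.1 v hv) (Nat.not_lt_zero _)
      simp [this, iterConv, emptyIndicator, Finset.ne_empty_of_mem hv]
  | succ n ih =>
    rw [iterConv, subsetConv_apply]
    simp only [← ih, Finset.mul_sum]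
    rw [Finset.sum_sigma']
    refine Finset.sum_bij' (fun c _ => ⟨T.filter (c · = n), fun v => if c v = n then 0 else c v⟩)
      (fun p _ v => if v ∈ p.1 then n else p.2 v) ?_ ?_ ?_ ?_ ?_
    · intro c hc
      simp only [Finset.mem_sigma, Finset.mem_powerset, mem_extColorings] at hc ⊢
      grind
    · rintro ⟨S, c⟩ hc
      simp only [Finset.mem_sigma, Finset.mem_powerset, mem_extColorings] at hc ⊢
      grind
    · intro c hc
      simp only [mem_extColorings] at hc
      funext v
      simp only [Finset.mem_filter]
      grind
    · rintro ⟨S, c⟩ hc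
      simp only [Finset.mem_sigma, Finset.mem_powerset, mem_extColorings] at hc
      have h1 : T.filter (fun v => (if v ∈ S then n else c v) = n) = S := by
        ext v
        simp only [Finset.mem_filter]
        grind
      have h2 : (fun v => if (if v ∈ S then n else c v) = n then 0 else
          if v ∈ S then n else c v) = c := by
        funext v
        grind
      simp only [h1, h2]
    · intro c hc
      simp only [mem_extColorings] at hc
      rw [Finset.prod_range_succ, mul_comm]
      congr 1
      refine Finset.prod_congr rfl fun i hi => ?_
      congr 1
      ext v
      simp only [Finset.mem_filter, Finset.mem_sdiff]
      grind

theorem iterConv_congr {f g : ℕ → Finset W → ℚ} {n : ℕ} (h : ∀ i < n, f i = g i) :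
    iterConv f n = iterConv g n := by
  induction n with
  | zero => rfl
  | succ n ih =>
    rw [iterConv, iterConv, h n n.lt_succ_self, ih fun i hi => h i (hi.trans n.lt_succ_self)]

theorem iterConv_const (f : Finset W → ℚ) (n : ℕ) :
    iterConv (fun _ => f) n = (subsetConv f ^ n) emptyIndicator := by
  induction n with
  | zero => rfl
  | succ n ih => rw [iterConv, ih, pow_succ', Module.End.mul_apply]

theorem iterConv_ite (f g : Finset W → ℚ) (m n : ℕ) :
    iterConv (fun i => if i < m then g else f) (m + n) =
      (subsetConv f ^ n * subsetConv g ^ m) emptyIndicator := by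
  induction n with
  | zero =>
    rw [pow_zero, one_mul, ← iterConv_const]
    exact iterConv_congr fun i hi => if_pos hi
  | succ n ih =>
    rw [← add_assoc, iterConv, ih, if_neg (by omega), pow_succ', mul_assoc]
    rfl

theorem iterConv_neg_one_pow_mul (f : ℕ → Finset W → ℚ) (n : ℕ) (T : Finset W) :
    iterConv (fun i S => (-1) ^ S.card * f i S) n T = (-1) ^ T.card * iterConv f n T := by
  induction n generalizing T with
  | zero =>
    simp only [iterConv, emptyIndicator]
    split_ifs with h <;> simp [h]
  | succ n ih =>
    simp only [iterConv, subsetConv_apply, Finset.mul_sum]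
    refine Finset.sum_congr rfl fun S hS => ?_
    rw [ih, ← Finset.card_sdiff_add_card_eq_card (Finset.mem_powerset.1 hS), pow_add]
    ring

end SubsetConvolution

section AcyclicOrientations

variable {W : Type*}

/-- `R` is an acyclic orientation of the subgraph of `H` induced by `T`. -/
def IsAcyclicOrientation (H : SimpleGraph W) (T : Finset W) (R : W → W → Bool) : Prop :=
  (∀ u v, R u v = true → u ∈ T ∧ v ∈ T ∧ H.Adj u v) ∧
    (∀ u ∈ T, ∀ v ∈ T, H.Adj u v →
      (R u v = true ∨ R v u = true) ∧ ¬(R u v = true ∧ R v u = true)) ∧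
    ∀ u, ¬ Relation.TransGen (fun a b => R a b = true) u u

/-- The number of acyclic orientations of the subgraph of `H` induced by `T`. -/
noncomputable def acyclicCount (H : SimpleGraph W) (T : Finset W) : ℕ :=
  Nat.card {R : W → W → Bool // IsAcyclicOrientation H T R}

variable {H : SimpleGraph W} {T : Finset W}

theorem IsAcyclicOrientation.of_filter {c : W → ℕ} {R : W → W → Bool}
    (hR : IsAcyclicOrientation H T R) (i : ℕ) :
    IsAcyclicOrientation H (T.filter (c · = i)) fun u v => R u v && decide (c u = i ∧ c v = i) := by
  refine ⟨fun u v h => ?_, fun u hu v hv huv => ?_, fun u h => ?_⟩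
  · simp only [Bool.and_eq_true, decide_eq_true_eq] at h
    have := hR.1 u v h.1
    simp_all
  · rw [Finset.mem_filter] at hu hv
    simpa [hu.2, hv.2] using hR.2.1 u hu.1 v hv.1 huv
  · refine hR.2.2 u (Relation.TransGen.mono (fun a b hab => ?_) u u h)
    simp only [Bool.and_eq_true] at hab
    exact hab.1

open scoped Classical in
/-- Orient the edges of `H` inside `T` towards larger values of `c`, and the edges inside
the level sets of `c` according to `Q`. -/
noncomputable def glueOrientation (H : SimpleGraph W) (T : Finset W) (c : W → ℕ) {n : ℕ}
    (Q : Fin n → W → W → Bool) (u v : W) : Bool :=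
  decide ((u ∈ T ∧ v ∈ T ∧ H.Adj u v ∧ c u < c v) ∨ ∃ i, Q i u v = true)

theorem glueOrientation_eq_true {c : W → ℕ} {n : ℕ} {Q : Fin n → W → W → Bool} {u v : W} :
    glueOrientation H T c Q u v = true ↔
      (u ∈ T ∧ v ∈ T ∧ H.Adj u v ∧ c u < c v) ∨ ∃ i, Q i u v = true := by
  simp [glueOrientation]

section Glue

variable {c : W → ℕ} {n : ℕ} {Q : Fin n → W → W → Bool}

theorem level_eq_of_isAcyclicOrientation
    (hQ : ∀ i : Fin n, IsAcyclicOrientation H (T.filter (c · = i)) (Q i)) {i : Fin n} {u v : W}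
    (h : Q i u v = true) : c u = i ∧ c v = i := by
  have := (hQ i).1 u v h
  simp only [Finset.mem_filter] at this
  exact ⟨this.1.2, this.2.1.2⟩

theorem glueOrientation_le
    (hQ : ∀ i : Fin n, IsAcyclicOrientation H (T.filter (c · = i)) (Q i)) {u v : W}
    (h : glueOrientation H T c Q u v = true) : c u ≤ c v := by
  rcases glueOrientation_eq_true.1 h with h | ⟨i, h⟩
  · exact h.2.2.2.le
  · have := level_eq_of_isAcyclicOrientation hQ h
    omega

theorem glueOrientation_eq_of_level
    (hQ : ∀ i : Fin n, IsAcyclicOrientation H (T.filter (c · = i)) (Q i)) {i : Fin n} {u v : W}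
    (hu : c u = i) (hv : c v = i) : glueOrientation H T c Q u v = Q i u v := by
  rw [Bool.eq_iff_iff, glueOrientation_eq_true]
  constructor
  · rintro (h | ⟨j, h⟩)
    · omega
    · have := level_eq_of_isAcyclicOrientation hQ h
      rwa [Fin.ext (hu.symm.trans this.1)]
  · exact fun h => Or.inr ⟨i, h⟩

theorem isAcyclicOrientation_glueOrientation (hc : ∀ v ∈ T, c v < n)
    (hQ : ∀ i : Fin n, IsAcyclicOrientation H (T.filter (c · = i)) (Q i)) :
    IsAcyclicOrientation H T (glueOrientation H T c Q) := by
  have hmono : ∀ u v, Relation.TransGen (fun a b => glueOrientation H T c Q a b = true) u v →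
      c u ≤ c v := by
    intro u v h
    induction h with
    | single h => exact glueOrientation_le hQ h
    | tail _ h ih => exact ih.trans (glueOrientation_le hQ h)
  have hsupp : ∀ u v, glueOrientation H T c Q u v = true → u ∈ T ∧ v ∈ T ∧ H.Adj u v := by
    intro u v h
    rcases glueOrientation_eq_true.1 h with h | ⟨i, h⟩
    · exact ⟨h.1, h.2.1, h.2.2.1⟩
    · have := (hQ i).1 u v h
      simp only [Finset.mem_filter] at this
      exact ⟨this.1.1, this.2.1.1, this.2.2⟩
  have hlevel : ∀ (i : Fin n) u v,
      Relation.TransGen (fun a b => glueOrientation H T c Q a b = true) u v →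
      c u = i → c v = i → Relation.TransGen (fun a b => Q i a b = true) u v := by
    intro i u v h hu
    induction h with
    | single h =>
      intro hv
      exact .single (by rwa [← glueOrientation_eq_of_level hQ hu hv])
    | tail h' h ih =>
      intro hv
      have h1 := hmono _ _ h'
      have h2 := glueOrientation_le hQ h
      have h3 := le_antisymm (h2.trans hv.le) (hu.symm.le.trans h1)
      exact (ih h3).tail (by rwa [← glueOrientation_eq_of_level hQ h3 hv])
  refine ⟨hsupp, fun u hu v hv huv => ?_, fun u h => ?_⟩
  · rcases lt_trichotomy (c u) (c v) with h | h | h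
    · refine ⟨Or.inl (glueOrientation_eq_true.2 (Or.inl ⟨hu, hv, huv, h⟩)), fun h' => ?_⟩
      exact absurd (glueOrientation_le hQ h'.2) (not_le.2 h)
    · have := (hQ ⟨c u, hc u hu⟩).2.1 u (by simp [hu]) v (by simp [hv, h]) huv
      rwa [glueOrientation_eq_of_level hQ (i := ⟨c u, hc u hu⟩) rfl h.symm,
        glueOrientation_eq_of_level hQ (i := ⟨c u, hc u hu⟩) h.symm rfl]
    · refine ⟨Or.inr (glueOrientation_eq_true.2 (Or.inl ⟨hv, hu, huv.symm, h⟩)), fun h' => ?_⟩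
      exact absurd (glueOrientation_le hQ h'.1) (not_le.2 h)
  · have hu : u ∈ T := by
      obtain ⟨v, h, -⟩ := Relation.TransGen.head'_iff.1 h
      exact (hsupp u v h).1
    exact (hQ ⟨c u, hc u hu⟩).2.2 u (hlevel ⟨c u, hc u hu⟩ u u h rfl rfl)

end Glue

/-- Acyclic orientations weakly increasing along `c` amount to acyclic orientations of the
level sets of `c`. -/
theorem card_acyclicOrientation_monotone [Finite W] {c : W → ℕ} {n : ℕ} (hc : ∀ v ∈ T, c v < n) :
    Nat.card {R : W → W → Bool // IsAcyclicOrientation H T R ∧ ∀ u v, R u v = true → c u ≤ c v} =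
      ∏ i ∈ Finset.range n, acyclicCount H (T.filter (c · = i)) := by
  rw [Finset.prod_range]
  simp only [acyclicCount]
  rw [← Nat.card_pi]
  refine Nat.card_congr ⟨fun R i => ⟨_, R.2.1.of_filter i⟩, fun Q =>
    ⟨glueOrientation H T c fun i => (Q i).1,
      isAcyclicOrientation_glueOrientation hc fun i => (Q i).2,
      fun u v => glueOrientation_le fun i => (Q i).2⟩, ?_, ?_⟩
  · rintro ⟨R, hR, hRc⟩
    refine Subtype.ext (funext fun u => funext fun v => ?_)
    rw [Bool.eq_iff_iff, glueOrientation_eq_true]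
    simp only [Bool.and_eq_true, decide_eq_true_eq]
    constructor
    · rintro (⟨hu, hv, huv, hlt⟩ | ⟨i, h, -⟩)
      · exact (hR.2.1 u hu v hv huv).1.resolve_right fun h => absurd (hRc v u h) (not_le.2 hlt)
      · exact h
    · intro h
      obtain ⟨hu, hv, huv⟩ := hR.1 u v h
      rcases (hRc u v h).lt_or_eq with hlt | heq
      · exact Or.inl ⟨hu, hv, huv, hlt⟩
      · exact Or.inr ⟨⟨c u, hc u hu⟩, h, rfl, heq.symm⟩
  · intro Q
    have hQ := fun i => (Q i).2
    refine funext fun i => Subtype.ext (funext fun u => funext fun v => ?_)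
    by_cases h : c u = i ∧ c v = i
    · simp [h, glueOrientation_eq_of_level hQ h.1 h.2]
    · have : ¬ (Q i).1 u v = true := fun h' => h (level_eq_of_isAcyclicOrientation hQ h')
      simp [h, this]

open scoped Classical in
/-- The indicator of independent sets of `H`. -/
noncomputable def indepIndicator (H : SimpleGraph W) (S : Finset W) : ℚ :=
  if ∀ u ∈ S, ∀ v ∈ S, ¬ H.Adj u v then 1 else 0

theorem acyclicCount_of_indep {S : Finset W} (hS : ∀ u ∈ S, ∀ v ∈ S, ¬ H.Adj u v) :
    acyclicCount H S = 1 := by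
  rw [acyclicCount, Nat.card_eq_one_iff_unique]
  refine ⟨⟨fun R R' => Subtype.ext (funext fun u => funext fun v => ?_)⟩, ⟨fun _ _ => false, ?_⟩⟩
  · have : ∀ R : {R // IsAcyclicOrientation H S R}, R.1 u v = false := by
      intro R
      by_contra h
      have := R.2.1 u v (by simpa using h)
      exact hS u this.1 v this.2.1 this.2.2
    rw [this, this]
  · refine ⟨by simp, fun u hu v hv huv => absurd huv (hS u hu v hv), fun u h => ?_⟩
    obtain ⟨v, h, -⟩ := Relation.TransGen.head'_iff.1 h
    simp at h

theorem acyclicCount_empty : acyclicCount H (∅ : Finset W) = 1 :=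
  acyclicCount_of_indep (by simp)

/-- The sources of `R` in `T`. -/
def sources [Fintype W] (T : Finset W) (R : W → W → Bool) : Finset W :=
  T.filter fun v => ∀ u, R u v = false

theorem IsAcyclicOrientation.sources_nonempty [Fintype W] {R : W → W → Bool}
    (hR : IsAcyclicOrientation H T R) (hT : T.Nonempty) : (sources T R).Nonempty := by
  let r := Relation.TransGen fun a b => R a b = true
  have : Std.Irrefl r := ⟨hR.2.2⟩
  have : IsTrans W r := ⟨fun _ _ _ => Relation.TransGen.trans⟩
  obtain ⟨v, hv, hmin⟩ := (Finite.wellFounded_of_trans_of_irrefl r).has_min (T : Set W) hT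
  refine ⟨v, Finset.mem_filter.2 ⟨hv, fun u => ?_⟩⟩
  by_contra h
  have h : R u v = true := by simpa using h
  exact hmin u (hR.1 u v h).1 (.single h)

theorem indepIndicator_mul_acyclicCount [Fintype W] [DecidableEq W] {S : Finset W} (hS : S ⊆ T) :
    indepIndicator H S * acyclicCount H (T \ S) =
      Nat.card {R : W → W → Bool // IsAcyclicOrientation H T R ∧ S ⊆ sources T R} := by
  by_cases hI : ∀ u ∈ S, ∀ v ∈ S, ¬ H.Adj u v
  · rw [indepIndicator, if_pos hI, one_mul]
    have h := card_acyclicOrientation_monotone (H := H) (T := T)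
      (c := fun v => if v ∈ S then 0 else 1) (n := 2) (by intro v _; split_ifs <;> simp)
    have h0 : T.filter (fun v => (if v ∈ S then 0 else 1) = 0) = S := by grind
    have h1 : T.filter (fun v => (if v ∈ S then 0 else 1) = 1) = T \ S := by grind
    rw [Finset.prod_range_succ, Finset.prod_range_one, h0, h1, acyclicCount_of_indep hI,
      one_mul] at h
    rw [← h, Nat.cast_inj]
    refine Nat.card_congr (Equiv.subtypeEquivRight fun R => and_congr_right fun hR => ?_)
    constructor
    · intro h v hv
      refine Finset.mem_filter.2 ⟨hS hv, fun u => ?_⟩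
      by_contra h'
      have h' : R u v = true := by simpa using h'
      have := h u v h'
      have hu : u ∈ S := by
        by_contra hu
        simp [hu, hv] at this
      exact hI u hu v hv (hR.1 u v h').2.2
    · intro h u v huv
      have hv : v ∉ S := fun hv => by simpa [huv] using (Finset.mem_filter.1 (h hv)).2 u
      simp only [hv, if_false]
      split_ifs <;> simp
  · rw [indepIndicator, if_neg hI, zero_mul]
    symm
    rw [Nat.cast_eq_zero, Nat.card_eq_zero]
    refine Or.inl ⟨fun ⟨R, hR, hs⟩ => hI fun u hu v hv huv => ?_⟩
    have hu' := (Finset.mem_filter.1 (hs hu)).2 v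
    have hv' := (Finset.mem_filter.1 (hs hv)).2 u
    simpa [hu', hv'] using (hR.2.1 u (hS hu) v (hS hv) huv).1

/-- The number of acyclic orientations, with sign. -/
noncomputable def signedAcyclicCount (H : SimpleGraph W) (T : Finset W) : ℚ :=
  (-1) ^ T.card * acyclicCount H T

theorem subsetConv_indepIndicator_signedAcyclicCount [Fintype W] [DecidableEq W] :
    subsetConv (indepIndicator H) (signedAcyclicCount H) = emptyIndicator := by
  classical
  funext T
  rcases T.eq_empty_or_nonempty with rfl | hT
  · simp [subsetConv_apply, indepIndicator, signedAcyclicCount, acyclicCount_empty, emptyIndicator]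
  have key : ∀ S ∈ T.powerset, indepIndicator H S * signedAcyclicCount H (T \ S) =
      ∑ R : W → W → Bool with IsAcyclicOrientation H T R,
        (-1) ^ T.card * if S ⊆ sources T R then (-1) ^ S.card else 0 := by
    intro S hS
    have hS := Finset.mem_powerset.1 hS
    rw [signedAcyclicCount, mul_left_comm, indepIndicator_mul_acyclicCount hS,
      Nat.card_eq_fintype_card, Fintype.card_subtype, ← Finset.mul_sum, ← Finset.sum_filter,
      Finset.filter_filter, Finset.sum_const, nsmul_eq_mul,
      ← Finset.card_sdiff_add_card_eq_card hS, pow_add]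
    have : ((-1 : ℚ) ^ S.card) * (-1) ^ S.card = 1 := by rw [← mul_pow]; simp
    linear_combination (-((-1) ^ (T \ S).card : ℚ) *
      (Finset.univ.filter fun R => IsAcyclicOrientation H T R ∧ S ⊆ sources T R).card) * this
  rw [subsetConv_apply, Finset.sum_congr rfl key, Finset.sum_comm, emptyIndicator, if_neg hT.ne_empty]
  refine Finset.sum_eq_zero fun R hR => ?_
  rw [← Finset.mul_sum, ← Finset.sum_filter]
  have : T.powerset.filter (· ⊆ sources T R) = (sources T R).powerset := by
    ext S
    simp only [Finset.mem_filter, Finset.mem_powerset, and_iff_right_iff_imp]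
    exact fun h => h.trans (Finset.filter_subset _ _)
  have hs := Finset.sum_powerset_neg_one_pow_card_of_nonempty
    ((Finset.mem_filter.1 hR).2.sources_nonempty hT)
  rw [this]
  have hs' : (∑ S ∈ (sources T R).powerset, (-1 : ℚ) ^ S.card) = 0 := by exact_mod_cast hs
  rw [hs', mul_zero]

end AcyclicOrientations

section Reciprocity

variable {W : Type*} {H : SimpleGraph W} {T : Finset W}

open scoped Classical in
/-- Set the value of `f` to zero on sets meeting `C`. -/
noncomputable def avoiding (C : W → Prop) (f : Finset W → ℚ) (S : Finset W) : ℚ :=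
  if ∀ v ∈ S, ¬ C v then f S else 0

open scoped Classical in
theorem subsetConv_avoiding [DecidableEq W] {C : W → Prop} {f g : Finset W → ℚ}
    (h : subsetConv f g = emptyIndicator) :
    subsetConv (avoiding C f) (avoiding C g) = emptyIndicator := by
  funext T
  by_cases hT : ∀ v ∈ T, ¬ C v
  · rw [← h, subsetConv_apply, subsetConv_apply]
    refine Finset.sum_congr rfl fun S hS => ?_
    have hS := Finset.mem_powerset.1 hS
    rw [avoiding, avoiding, if_pos fun v hv => hT v (hS hv),
      if_pos fun v hv => hT v (Finset.sdiff_subset hv)]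
  · have hne : T ≠ ∅ := by rintro rfl; simp at hT
    rw [subsetConv_apply, emptyIndicator, if_neg hne]
    refine Finset.sum_eq_zero fun S hS => ?_
    by_contra h0
    rw [avoiding, avoiding] at h0
    refine hT fun v hv => ?_
    have h1 := (ite_ne_right_iff.1 (left_ne_zero_of_mul h0)).1
    have h2 := (ite_ne_right_iff.1 (right_ne_zero_of_mul h0)).1
    by_cases hvS : v ∈ S
    · exact h1 v hvS
    · exact h2 v (Finset.mem_sdiff.2 ⟨hv, hvS⟩)

theorem avoiding_neg_one_pow_mul (C : W → Prop) (f : Finset W → ℚ) :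
    avoiding C (fun S => (-1) ^ S.card * f S) = fun S => (-1) ^ S.card * avoiding C f S := by
  funext S
  simp [avoiding]

open scoped Classical in
theorem prod_avoiding {C : W → Prop} (f : Finset W → ℚ) {c : W → ℕ} {m n : ℕ}
    (hc : ∀ v ∈ T, c v < n) :
    ∏ i ∈ Finset.range n, (if i < m then avoiding C f else f) (T.filter (c · = i)) =
      if ∀ v ∈ T, C v → m ≤ c v then ∏ i ∈ Finset.range n, f (T.filter (c · = i)) else 0 := by
  split_ifs with h
  · refine Finset.prod_congr rfl fun i _ => ?_
    split_ifs with him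
    · refine if_pos fun v hv hCv => ?_
      rw [Finset.mem_filter] at hv
      have := h v hv.1 hCv
      omega
    · rfl
  · push Not at h
    obtain ⟨v, hv, hCv, hlt⟩ := h
    refine Finset.prod_eq_zero (Finset.mem_range.2 (hc v hv)) ?_
    rw [if_pos hlt]
    exact if_neg fun h => h v (by simp [hv]) hCv

open scoped Classical in
theorem prod_indepIndicator {c : W → ℕ} {n : ℕ} (hc : ∀ v ∈ T, c v < n) :
    ∏ i ∈ Finset.range n, indepIndicator H (T.filter (c · = i)) =
      if ∀ u ∈ T, ∀ v ∈ T, H.Adj u v → c u ≠ c v then 1 else 0 := by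
  split_ifs with h
  · refine Finset.prod_eq_one fun i _ => if_pos fun u hu v hv huv => ?_
    rw [Finset.mem_filter] at hu hv
    exact h u hu.1 v hv.1 huv (hu.2.trans hv.2.symm)
  · push Not at h
    obtain ⟨u, hu, v, hv, huv, heq⟩ := h
    exact Finset.prod_eq_zero (Finset.mem_range.2 (hc u hu))
      (if_neg fun h => h u (by simp [hu]) v (by simp [hv, heq]) huv)

theorem card_prod_coloring [Fintype W] [DecidableEq W] {A : Type*} [Finite A] (n : ℕ)
    (Q : A → ({v // v ∈ T} → ℤ) → Prop) :
    Nat.card {p : A × ({v // v ∈ T} → ℤ) // (∀ v, 1 ≤ p.2 v ∧ p.2 v ≤ n) ∧ Q p.1 p.2} =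
      ∑ c ∈ extColorings T n, Nat.card {a : A // Q a fun v => c v + 1} := by
  rw [← Finset.sum_coe_sort, ← Nat.card_sigma]
  symm
  refine Nat.card_congr (Equiv.ofBijective (fun p => ⟨(p.2.1, fun v => p.1.1 v + 1), ?_, p.2.2⟩)
    ⟨?_, ?_⟩)
  · intro v
    have := (mem_extColorings.1 p.1.2).1 v v.2
    dsimp only
    omega
  · rintro ⟨⟨c, hc⟩, a, ha⟩ ⟨⟨c', hc'⟩, a', ha'⟩ h
    simp only [Subtype.mk.injEq, Prod.mk.injEq] at h
    obtain ⟨rfl, h⟩ := h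
    have : c = c' := by
      funext v
      rw [mem_extColorings] at hc hc'
      by_cases hv : v ∈ T
      · simpa using congr_fun h ⟨v, hv⟩
      · rw [hc.2 v hv, hc'.2 v hv]
    subst this
    rfl
  · rintro ⟨⟨a, d⟩, hd, hQ⟩
    have hd' : (fun v : {v // v ∈ T} =>
        (((if h : v.1 ∈ T then (d ⟨v.1, h⟩ - 1).toNat else 0 : ℕ) : ℤ)) + 1) = d := by
      funext v
      have := hd v
      simp only [v.2, dif_pos, Subtype.coe_eta] at this ⊢
      omega
    refine ⟨⟨⟨fun v => if h : v ∈ T then (d ⟨v, h⟩ - 1).toNat else 0, ?_⟩, a, ?_⟩, ?_⟩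
    · rw [mem_extColorings]
      refine ⟨fun v hv => ?_, fun v hv => by simp [hv]⟩
      have := hd ⟨v, hv⟩
      simp only [hv, dif_pos] at this ⊢
      omega
    · rw [hd']
      exact hQ
    · exact Subtype.ext (Prod.ext rfl hd')

theorem natCast_card_punit_subtype (p : Prop) [Decidable p] :
    (Nat.card {_a : PUnit.{1} // p} : ℚ) = if p then 1 else 0 := by
  split_ifs with h <;> simp [h]

theorem card_properColoring [Fintype W] [DecidableEq W] (H : SimpleGraph W) (C : W → Prop)
    (T : Finset W) (m k : ℕ) :
    (Nat.card {d : {v // v ∈ T} → ℤ // (∀ v, 1 ≤ d v ∧ d v ≤ (m + k : ℕ)) ∧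
      (∀ u v : {v // v ∈ T}, H.Adj u v → d u ≠ d v) ∧ ∀ v : {v // v ∈ T}, C v → m < d v} : ℚ) =
    (subsetConv (indepIndicator H) ^ k * subsetConv (avoiding C (indepIndicator H)) ^ m)
      emptyIndicator T := by
  classical
  rw [← iterConv_ite, ← sum_extColorings_prod,
    ← Nat.card_congr (Equiv.subtypeEquiv (Equiv.punitProd.{0} ({v // v ∈ T} → ℤ))
      (p := fun p => (∀ v, 1 ≤ p.2 v ∧ p.2 v ≤ ((m + k : ℕ) : ℤ)) ∧
        (∀ u v : {v // v ∈ T}, H.Adj u v → p.2 u ≠ p.2 v) ∧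
        ∀ v : {v // v ∈ T}, C v → (m : ℤ) < p.2 v)
      fun _ => Iff.rfl),
    card_prod_coloring (m + k) fun _ d => (∀ u v : {v // v ∈ T}, H.Adj u v → d u ≠ d v) ∧
      ∀ v : {v // v ∈ T}, C v → m < d v, Nat.cast_sum]
  refine Finset.sum_congr rfl fun c hc => ?_
  have hc := (mem_extColorings.1 hc).1
  rw [prod_avoiding _ hc, prod_indepIndicator hc, ← ite_and]
  have hiff : ((∀ u v : {v // v ∈ T}, H.Adj u v → ((c u : ℤ) + 1) ≠ c v + 1) ∧
      ∀ v : {v // v ∈ T}, C v → (m : ℤ) < c v + 1) ↔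
      (∀ v ∈ T, C v → m ≤ c v) ∧ ∀ u ∈ T, ∀ v ∈ T, H.Adj u v → c u ≠ c v := by
    simp only [Subtype.forall, ne_eq, add_left_inj, Nat.cast_inj, Int.lt_add_one_iff, Nat.cast_le]
    tauto
  simp only [hiff]
  convert natCast_card_punit_subtype _

theorem card_acyclicOrientation_coloring [Fintype W] [DecidableEq W] (H : SimpleGraph W)
    (C : W → Prop) (T : Finset W) (m k : ℕ) :
    (-1) ^ T.card * (Nat.card {p : (W → W → Bool) × ({v // v ∈ T} → ℤ) //
      IsAcyclicOrientation H T p.1 ∧ (∀ v, 1 ≤ p.2 v ∧ p.2 v ≤ (m + k : ℕ)) ∧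
      (∀ u v : {v // v ∈ T}, p.1 u v = true → p.2 u ≤ p.2 v) ∧
      ∀ v : {v // v ∈ T}, C v → m < p.2 v} : ℚ) =
    (subsetConv (signedAcyclicCount H) ^ k * subsetConv (avoiding C (signedAcyclicCount H)) ^ m)
      emptyIndicator T := by
  classical
  have hsigned : signedAcyclicCount H = fun S => (-1) ^ S.card * (acyclicCount H S : ℚ) := rfl
  rw [← iterConv_ite, hsigned, avoiding_neg_one_pow_mul]
  have hite : (fun i : ℕ => if i < m
      then (fun S => (-1) ^ S.card * avoiding C (fun S => (acyclicCount H S : ℚ)) S)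
      else fun S => (-1) ^ S.card * (acyclicCount H S : ℚ)) =
      fun i S => (-1) ^ S.card * (if i < m then avoiding C fun S => (acyclicCount H S : ℚ)
        else fun S => (acyclicCount H S : ℚ)) S := by
    funext i
    split_ifs <;> rfl
  rw [hite, iterConv_neg_one_pow_mul, ← sum_extColorings_prod]
  congr 1
  rw [Nat.card_congr (Equiv.subtypeEquivRight fun _ => and_left_comm),
    card_prod_coloring (m + k) fun R d => IsAcyclicOrientation H T R ∧
      (∀ u v : {v // v ∈ T}, R u v = true → d u ≤ d v) ∧ ∀ v : {v // v ∈ T}, C v → m < d v,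
    Nat.cast_sum]
  refine Finset.sum_congr rfl fun c hc => ?_
  have hc := (mem_extColorings.1 hc).1
  rw [prod_avoiding _ hc, ← Nat.cast_prod, ← card_acyclicOrientation_monotone hc]
  split_ifs with h
  · rw [Nat.cast_inj]
    refine Nat.card_congr (Equiv.subtypeEquivRight fun R => and_congr_right fun hR => ?_)
    constructor
    · intro hh u v huv
      obtain ⟨hu, hv, -⟩ := hR.1 u v huv
      have := hh.1 ⟨u, hu⟩ ⟨v, hv⟩ huv
      dsimp only at this
      omega
    · intro hh
      refine ⟨fun u v huv => ?_, fun v hv => ?_⟩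
      · have := hh u v huv
        dsimp only
        omega
      · have := h v v.2 hv
        dsimp only
        omega
  · rw [Nat.cast_eq_zero, Nat.card_eq_zero]
    refine Or.inl ⟨fun ⟨R, hR⟩ => h fun v hv hCv => ?_⟩
    have := hR.2.2 ⟨v, hv⟩ hCv
    dsimp only at this
    omega

theorem exists_coloring_reciprocity_polynomial [Finite W] (H : SimpleGraph W) (C : W → Prop)
    (T : Finset W) (m k : ℕ) :
    ∃ q : Polynomial ℚ,
      (∀ t : ℕ, q.eval (t : ℚ) = (Nat.card {d : {v // v ∈ T} → ℤ //
        (∀ v, 1 ≤ d v ∧ d v ≤ (m * t + k * t : ℕ)) ∧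
        (∀ u v : {v // v ∈ T}, H.Adj u v → d u ≠ d v) ∧
        ∀ v : {v // v ∈ T}, C v → (m * t : ℕ) < d v} : ℚ)) ∧
      q.eval (-1) = (-1) ^ T.card * (Nat.card {p : (W → W → Bool) × ({v // v ∈ T} → ℤ) //
        IsAcyclicOrientation H T p.1 ∧ (∀ v, 1 ≤ p.2 v ∧ p.2 v ≤ (m + k : ℕ)) ∧
        (∀ u v : {v // v ∈ T}, p.1 u v = true → p.2 u ≤ p.2 v) ∧
        ∀ v : {v // v ∈ T}, C v → m < p.2 v} : ℚ) := by
  classical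
  have := Fintype.ofFinite W
  set f := indepIndicator H
  set g := avoiding C f
  have hf : f ∅ = 1 := by simp [f, indepIndicator]
  have hg : g ∅ = 1 := by simp [g, avoiding, hf]
  have hfi := subsetConv_indepIndicator_signedAcyclicCount (H := H)
  have hf' : (1 + (subsetConv f - 1)) * subsetConv (signedAcyclicCount H) = 1 := by
    rw [add_sub_cancel, subsetConv_mul, hfi, subsetConv_emptyIndicator]
  have hg' : (1 + (subsetConv g - 1)) * subsetConv (avoiding C (signedAcyclicCount H)) = 1 := by
    rw [add_sub_cancel, subsetConv_mul, subsetConv_avoiding hfi, subsetConv_emptyIndicator]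
  have hfN := subsetConv_sub_one_pow hf
  have hgN := subsetConv_sub_one_pow hg
  obtain ⟨q, hq⟩ := exists_polynomial_eval_eq_binomSum_mul (subsetConv f - 1) (subsetConv g - 1)
    (Fintype.card W + 1) ((LinearMap.proj T).comp (LinearMap.applyₗ emptyIndicator)) k m
  refine ⟨q, fun t => ?_, ?_⟩
  · rw [card_properColoring, hq, ← Nat.cast_mul, ← Nat.cast_mul, binomSum_natCast hfN,
      binomSum_natCast hgN, add_sub_cancel, add_sub_cancel]
    rfl
  · rw [card_acyclicOrientation_coloring, hq, mul_neg_one, mul_neg_one,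
      binomSum_neg_natCast hfN hf', binomSum_neg_natCast hgN hg']
    rfl

end Reciprocity

section Flats

variable {V : Type*}

/-- The graph on sets of vertices of `G` in which distinct sets joined by an edge of `G` are
adjacent; its restriction to a partition is the corresponding contraction of `G`. -/
def setGraph (G : SimpleGraph V) : SimpleGraph (Finset V) where
  Adj B B' := B ≠ B' ∧ ∃ v ∈ B, ∃ w ∈ B', G.Adj v w
  symm := ⟨fun _ _ ⟨hne, v, hv, w, hw, h⟩ => ⟨hne.symm, w, hw, v, hv, h.symm⟩⟩
  loopless := ⟨fun _ h => h.1 rfl⟩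

/-- `P` is a partition of the vertices into sets inducing connected subgraphs of `G`. -/
def IsConnectedPartition (G : SimpleGraph V) (P : Finset (Finset V)) : Prop :=
  (∀ B ∈ P, B.Nonempty) ∧ (∀ v : V, ∃! B, B ∈ P ∧ v ∈ B) ∧
    ∀ B ∈ P, (G.induce (B : Set V)).Connected

/-- `c` is induced by a proper coloring of the contraction of `G` along `P` in which blocks with
at least two elements have colors larger than `y`. -/
def IsFlatColoring (G : SimpleGraph V) (y : ℤ) (P : Finset (Finset V)) (c : V → ℤ) : Prop :=
  (∀ B ∈ P, ∀ v ∈ B, ∀ w ∈ B, c v = c w) ∧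
    (∀ B ∈ P, ∀ B' ∈ P, (setGraph G).Adj B B' → ∀ v ∈ B, ∀ w ∈ B', c v ≠ c w) ∧
    ∀ B ∈ P, 2 ≤ B.card → ∀ v ∈ B, y < c v

/-- The subgraph of edges whose ends have the same color. -/
def monochromatic (G : SimpleGraph V) (c : V → ℤ) : SimpleGraph V where
  Adj v w := G.Adj v w ∧ c v = c w
  symm := ⟨fun _ _ h => ⟨h.1.symm, h.2.symm⟩⟩
  loopless := ⟨fun _ h => h.1.ne rfl⟩

variable {G : SimpleGraph V} {P : Finset (Finset V)} {c : V → ℤ} {y : ℤ}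

theorem color_eq_of_reachable_monochromatic {v w : V} (h : (monochromatic G c).Reachable v w) :
    c v = c w := by
  obtain ⟨p⟩ := h
  induction p with
  | nil => rfl
  | cons h _ ih => exact h.2.trans ih

theorem IsConnectedPartition.eq_of_mem (hP : IsConnectedPartition G P) {B B' : Finset V} {v : V}
    (hB : B ∈ P) (hB' : B' ∈ P) (hv : v ∈ B) (hv' : v ∈ B') : B = B' :=
  (hP.2.1 v).unique ⟨hB, hv⟩ ⟨hB', hv'⟩

theorem IsFlatColoring.mem_of_monochromatic_adj (hP : IsConnectedPartition G P)
    (h : IsFlatColoring G y P c) {B : Finset V} (hB : B ∈ P) {v w : V} (hv : v ∈ B)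
    (hvw : (monochromatic G c).Adj v w) : w ∈ B := by
  obtain ⟨B', ⟨hB', hw⟩, -⟩ := hP.2.1 w
  by_cases hne : B = B'
  · rwa [hne]
  · exact absurd hvw.2 (h.2.1 B hB B' hB' ⟨hne, v, hv, w, hw, hvw.1⟩ v hv w hw)

theorem IsFlatColoring.mem_iff_reachable (hP : IsConnectedPartition G P)
    (h : IsFlatColoring G y P c) {B : Finset V} (hB : B ∈ P) {v : V} (hv : v ∈ B) (w : V) :
    w ∈ B ↔ (monochromatic G c).Reachable v w := by
  constructor
  · intro hw
    have hr := (hP.2.2 B hB).preconnected ⟨v, hv⟩ ⟨w, hw⟩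
    exact hr.map (⟨Subtype.val, fun {a b} hab => ⟨hab, h.1 B hB a a.2 b b.2⟩⟩ :
      G.induce (B : Set V) →g monochromatic G c)
  · rintro ⟨p⟩
    induction p with
    | nil => exact hv
    | cons hadj _ ih => exact ih (h.mem_of_monochromatic_adj hP hB hv hadj)

theorem IsFlatColoring.lt_of_monochromatic_adj (hP : IsConnectedPartition G P)
    (h : IsFlatColoring G y P c) {v w : V} (hvw : (monochromatic G c).Adj v w) : y < c v := by
  obtain ⟨B, ⟨hB, hv⟩, -⟩ := hP.2.1 v
  have hw := h.mem_of_monochromatic_adj hP hB hv hvw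
  exact h.2.2 B hB (Finset.one_lt_card.2 ⟨v, hv, w, hw, hvw.1.ne⟩) v hv

theorem IsFlatColoring.partition_unique {P' : Finset (Finset V)} (hP : IsConnectedPartition G P)
    (hP' : IsConnectedPartition G P') (h : IsFlatColoring G y P c) (h' : IsFlatColoring G y P' c) :
    P = P' := by
  have key : ∀ {P P' : Finset (Finset V)}, IsConnectedPartition G P → IsConnectedPartition G P' →
      IsFlatColoring G y P c → IsFlatColoring G y P' c → P ⊆ P' := by
    intro P P' hP hP' h h' B hB
    obtain ⟨v, hv⟩ := hP.1 B hB
    obtain ⟨B', ⟨hB', hv'⟩, -⟩ := hP'.2.1 v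
    have : B = B' := by
      ext w
      rw [h.mem_iff_reachable hP hB hv, h'.mem_iff_reachable hP' hB' hv']
    rwa [this]
  exact (key hP hP' h h').antisymm (key hP' hP h' h)

theorem exists_isFlatColoring [Finite V] (hc : ∀ v w, (monochromatic G c).Adj v w → y < c v) :
    ∃ P, IsConnectedPartition G P ∧ IsFlatColoring G y P c := by
  classical
  have := Fintype.ofFinite V
  let comp (v : V) : Finset V := {w | (monochromatic G c).Reachable v w}
  have mem_comp : ∀ {v w}, w ∈ comp v ↔ (monochromatic G c).Reachable v w := by simp [comp]
  have comp_eq : ∀ {v w}, w ∈ comp v → comp v = comp w := by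
    intro v w h
    ext u
    rw [mem_comp] at h
    rw [mem_comp, mem_comp]
    exact ⟨h.symm.trans, h.trans⟩
  have hP : ∀ {B}, B ∈ Finset.univ.image comp ↔ ∃ v, comp v = B := by simp
  refine ⟨Finset.univ.image comp, ⟨?_, ?_, ?_⟩, ?_, ?_, ?_⟩
  · intro B hB
    obtain ⟨v, rfl⟩ := hP.1 hB
    exact ⟨v, mem_comp.2 (.refl v)⟩
  · intro v
    refine ⟨comp v, ⟨hP.2 ⟨v, rfl⟩, mem_comp.2 (.refl v)⟩, ?_⟩
    rintro B ⟨hB, hv⟩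
    obtain ⟨w, rfl⟩ := hP.1 hB
    exact comp_eq hv
  · intro B hB
    obtain ⟨v, rfl⟩ := hP.1 hB
    have hv : v ∈ comp v := mem_comp.2 (.refl v)
    rw [SimpleGraph.connected_iff_exists_forall_reachable]
    refine ⟨⟨v, hv⟩, fun ⟨w, hw⟩ => ?_⟩
    have hstep : ∀ {a b : V} (_ : (monochromatic G c).Walk a b) (ha : a ∈ comp v)
        (hb : b ∈ comp v), (G.induce (comp v : Set V)).Reachable ⟨a, ha⟩ ⟨b, hb⟩ := by
      intro a b p
      induction p with
      | nil => exact fun _ _ => .refl _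
      | @cons a a' b hadj p ih =>
        intro ha hb
        have ha' : a' ∈ comp v := mem_comp.2 ((mem_comp.1 ha).trans hadj.reachable)
        have hadj' : (G.induce (comp v : Set V)).Adj ⟨a, ha⟩ ⟨a', ha'⟩ := hadj.1
        exact hadj'.reachable.trans (ih ha' hb)
    obtain ⟨p⟩ := mem_comp.1 hw
    exact hstep p hv hw
  · intro B hB v hv w hw
    obtain ⟨u, rfl⟩ := hP.1 hB
    exact color_eq_of_reachable_monochromatic ((mem_comp.1 hv).symm.trans (mem_comp.1 hw))
  · rintro B hB B' hB' ⟨hne, a, ha, b, hb, hab⟩ v hv w hw heq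
    obtain ⟨u, rfl⟩ := hP.1 hB
    obtain ⟨u', rfl⟩ := hP.1 hB'
    have hav := color_eq_of_reachable_monochromatic ((mem_comp.1 ha).symm.trans (mem_comp.1 hv))
    have hbw := color_eq_of_reachable_monochromatic ((mem_comp.1 hb).symm.trans (mem_comp.1 hw))
    have hadj : (monochromatic G c).Adj a b := ⟨hab, hav.trans (heq.trans hbw.symm)⟩
    exact hne ((comp_eq ha).trans ((comp_eq (mem_comp.2 hadj.reachable)).trans (comp_eq hb).symm))
  · intro B hB hcard v hv
    obtain ⟨u, rfl⟩ := hP.1 hB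
    obtain ⟨w, hw, hne⟩ := Finset.exists_mem_ne hcard v
    obtain ⟨p⟩ := (mem_comp.1 hv).symm.trans (mem_comp.1 hw)
    cases p with
    | nil => exact absurd rfl hne
    | cons hadj _ => exact hc _ _ hadj

theorem finite_boundedColorings [Finite V] (x : ℤ) (Q : (V → ℤ) → Prop) :
    Finite {c : V → ℤ // (∀ v, 1 ≤ c v ∧ c v ≤ x) ∧ Q c} := by
  classical
  have := Fintype.ofFinite V
  refine ((Set.finite_Icc (fun _ : V => (1 : ℤ)) fun _ => x).subset ?_).to_subtype
  exact fun c hc => ⟨fun v => (hc.1 v).1, fun v => (hc.1 v).2⟩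

open scoped Classical in
theorem card_bivariateColoring [Fintype V] (G : SimpleGraph V) (x y : ℤ) :
    Nat.card {c : V → ℤ // (∀ v, 1 ≤ c v ∧ c v ≤ x) ∧
      ∀ v w : V, G.Adj v w → (c v ≠ c w ∨ (c v = c w ∧ y < c v))} =
    ∑ P : Finset (Finset V) with IsConnectedPartition G P,
      Nat.card {c : V → ℤ // (∀ v, 1 ≤ c v ∧ c v ≤ x) ∧ IsFlatColoring G y P c} := by
  have := fun P => finite_boundedColorings x (IsFlatColoring G y P)
  rw [Finset.sum_subtype (p := IsConnectedPartition G) _ (by simp), ← Nat.card_sigma]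
  symm
  refine Nat.card_congr (Equiv.ofBijective (fun p => ⟨p.2.1, p.2.2.1, fun v w hvw => ?_⟩) ⟨?_, ?_⟩)
  · by_cases heq : p.2.1 v = p.2.1 w
    · exact Or.inr ⟨heq, p.2.2.2.lt_of_monochromatic_adj p.1.2 ⟨hvw, heq⟩⟩
    · exact Or.inl heq
  · rintro ⟨⟨P, hP⟩, c, hc⟩ ⟨⟨P', hP'⟩, c', hc'⟩ h
    obtain rfl : c = c' := congrArg Subtype.val h
    obtain rfl := hc.2.partition_unique hP hP' hc'.2
    rfl
  · rintro ⟨c, hc, hc'⟩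
    obtain ⟨P, hP, h⟩ := exists_isFlatColoring (G := G) (c := c) (y := y) fun v w hvw =>
      ((hc' v w hvw.1).resolve_left (not_not.2 hvw.2)).2
    exact ⟨⟨⟨P, hP⟩, c, hc, h⟩, rfl⟩

theorem IsConnectedPartition.card_isFlatColoring (hP : IsConnectedPartition G P) (x y : ℤ) :
    Nat.card {c : V → ℤ // (∀ v, 1 ≤ c v ∧ c v ≤ x) ∧ IsFlatColoring G y P c} =
    Nat.card {d : {B // B ∈ P} → ℤ // (∀ B, 1 ≤ d B ∧ d B ≤ x) ∧
      (∀ B B' : {B // B ∈ P}, (setGraph G).Adj B B' → d B ≠ d B') ∧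
      ∀ B : {B // B ∈ P}, 2 ≤ B.1.card → y < d B} := by
  choose block hblock using fun v => (hP.2.1 v).exists
  choose rep hrep using hP.1
  have hbe : ∀ {B v}, B ∈ P → v ∈ B → block v = B := fun hB hv =>
    hP.eq_of_mem (hblock _).1 hB (hblock _).2 hv
  refine Nat.card_congr ⟨fun c => ⟨fun B => c.1 (rep B.1 B.2), fun B => c.2.1 _,
      fun B B' h => c.2.2.2.1 B.1 B.2 B'.1 B'.2 h _ (hrep _ _) _ (hrep _ _),
      fun B h => c.2.2.2.2 B.1 B.2 h _ (hrep _ _)⟩,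
    fun d => ⟨fun v => d.1 ⟨block v, (hblock v).1⟩, fun v => d.2.1 _, ?_, ?_, ?_⟩, ?_, ?_⟩
  · intro B hB v hv w hw
    simp only [hbe hB hv, hbe hB hw]
  · intro B hB B' hB' h v hv w hw
    simp only [hbe hB hv, hbe hB' hw]
    exact d.2.2.1 ⟨B, hB⟩ ⟨B', hB'⟩ h
  · intro B hB h v hv
    simp only [hbe hB hv]
    exact d.2.2.2 ⟨B, hB⟩ h
  · rintro ⟨c, hc, hc'⟩
    exact Subtype.ext (funext fun v =>
      hc'.1 (block v) (hblock v).1 _ (hrep _ _) v (hblock v).2)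
  · rintro ⟨d, hd⟩
    refine Subtype.ext (funext fun B => ?_)
    simp only [hbe B.2 (hrep _ _)]

end Flats

open scoped Classical in
/-- Let `G` be a finite simple graph and `p ∈ ℚ[X,Y]` a polynomial with
`p(x,y) = χ_G(x,y)` for all integers `x ≥ 1`, `0 ≤ y ≤ x`.  Then for all integers `x ≥ 1`
and `0 ≤ y ≤ x-1`, `p(-x,-y) = Σ_π (-1)^{|π|} m_π(x,y)`, where `π` ranges over partitions
of `V` all of whose blocks induce connected subgraphs of `G`, `|π|` is the number of
blocks, and `m_π(x,y)` counts pairs `(σ,c)` of an acyclic orientation `σ` of the flat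
`H_π` and a map `c` on blocks with `1 ≤ c ≤ x`, `c(B) ≤ c(B')` whenever `σ` orients an
edge from `B` to `B'`, and `c(B) > y` for blocks of size `≥ 2`. -/
theorem stmt_12 (V : Type) [Fintype V] (G : SimpleGraph V)
    (p : MvPolynomial (Fin 2) ℚ)
    (hp : ∀ x y : ℤ, 1 ≤ x → 0 ≤ y → y ≤ x →
      MvPolynomial.eval ![(x : ℚ), (y : ℚ)] p
        = (Nat.card {c : V → ℤ //
            (∀ v, 1 ≤ c v ∧ c v ≤ x) ∧
            (∀ v w : V, G.Adj v w → (c v ≠ c w ∨ (c v = c w ∧ y < c v)))} : ℚ))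
    (x y : ℤ) (hx : 1 ≤ x) (hy : 0 ≤ y) (hyx : y ≤ x - 1) :
    MvPolynomial.eval ![(-x : ℚ), (-y : ℚ)] p
      = ∑ P ∈ Finset.univ.filter (fun P : Finset (Finset V) =>
            (∀ B ∈ P, B.Nonempty) ∧
            (∀ v : V, ∃! B, B ∈ P ∧ v ∈ B) ∧
            (∀ B ∈ P, (G.induce (B : Set V)).Connected)),
          (-1 : ℚ) ^ P.card *
            (Nat.card {σc : (Finset V → Finset V → Bool) × ({B : Finset V // B ∈ P} → ℤ) //
              ((∀ B B' : Finset V, σc.1 B B' = true →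
                  B ∈ P ∧ B' ∈ P ∧ B ≠ B' ∧ ∃ v ∈ B, ∃ w ∈ B', G.Adj v w) ∧
                (∀ B ∈ P, ∀ B' ∈ P, (B ≠ B' ∧ ∃ v ∈ B, ∃ w ∈ B', G.Adj v w) →
                  ((σc.1 B B' = true ∨ σc.1 B' B = true) ∧
                    ¬(σc.1 B B' = true ∧ σc.1 B' B = true))) ∧
                (∀ B : Finset V, ¬ Relation.TransGen (fun A A' => σc.1 A A' = true) B B)) ∧
              (∀ B, 1 ≤ σc.2 B ∧ σc.2 B ≤ x) ∧
              (∀ B B' : {B : Finset V // B ∈ P}, σc.1 B.1 B'.1 = true → σc.2 B ≤ σc.2 B') ∧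
              (∀ B : {B : Finset V // B ∈ P}, 2 ≤ B.1.card → y < σc.2 B)} : ℚ) := by
  obtain ⟨m, rfl⟩ := Int.eq_ofNat_of_zero_le hy
  obtain ⟨k, hk⟩ := Int.eq_ofNat_of_zero_le (show 0 ≤ x - m by omega)
  obtain rfl : x = ((m + k : ℕ) : ℤ) := by omega
  choose q hq hq' using fun P : Finset (Finset V) =>
    exists_coloring_reciprocity_polynomial (setGraph G) (fun B => 2 ≤ B.card) P m k
  let r : Polynomial ℚ := MvPolynomial.aeval
    ![Polynomial.C ((m + k : ℕ) : ℚ) * Polynomial.X, Polynomial.C (m : ℚ) * Polynomial.X] p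
  have hr : ∀ t : ℚ, r.eval t = MvPolynomial.eval ![((m + k : ℕ) : ℚ) * t, (m : ℚ) * t] p := by
    intro t
    simp only [r]
    rw [← Polynomial.coe_evalRingHom, MvPolynomial.aeval_def, MvPolynomial.eval₂_eq',
      MvPolynomial.eval_eq', map_sum]
    simp [Fin.prod_univ_two]
  have hrq : r = ∑ P : Finset (Finset V) with IsConnectedPartition G P, q P := by
    refine Polynomial.eq_of_infinite_eval_eq _ _
      ((Set.infinite_range_of_injective (f := fun t : ℕ => ((t + 1 : ℕ) : ℚ)) fun a b h => ?_).mono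
        ?_)
    · simpa using h
    · rintro _ ⟨t, rfl⟩
      have hpt := hp ((m * (t + 1) + k * (t + 1) : ℕ) : ℤ) ((m * (t + 1) : ℕ) : ℤ)
        (by exact_mod_cast Nat.succ_le_of_lt (by
          rw [← add_mul]
          exact Nat.mul_pos (by omega) t.succ_pos))
        (by positivity) (by exact_mod_cast Nat.le_add_right _ _)
      rw [card_bivariateColoring, Nat.cast_sum] at hpt
      rw [Set.mem_ofPred_eq, hr, Polynomial.eval_finsetSum]
      calc _ = _ := by
            congr 2
            push_cast
            ring_nf
        _ = _ := hpt
        _ = _ := Finset.sum_congr rfl fun P hP => by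
          rw [hq, (Finset.mem_filter.1 hP).2.card_isFlatColoring]
  have hneg := hr (-1)
  rw [hrq, Polynomial.eval_finsetSum] at hneg
  simp only [hq', mul_neg_one] at hneg
  rw [Int.cast_natCast, Int.cast_natCast, ← hneg]
  refine Finset.sum_congr ?_ fun _ _ => rfl
  ext P
  simp only [Finset.mem_filter]
  rfl
end

section
/- For every finite simple graph G = (V,E) there exists a polynomial p ∈ ℚ[X,Y] such that p(x,y) = χ_G(x,y) for all integers x and y with x ≥ 1 and 0 ≤ y ≤ x. -/
open Classical in
/-- The colorings `V → [1, x]` for which both ends of every pair in `F` share a color at most `y`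
are counted by a monomial in `x` and `y`. -/
theorem exists_mvPolynomial_card_forced {V : Type*} [Fintype V] (F : Finset (V × V)) :
    ∃ p : MvPolynomial (Fin 2) ℚ, ∀ x y : ℤ, 0 ≤ y → y ≤ x →
      MvPolynomial.eval ![(x : ℚ), (y : ℚ)] p
        = (((Fintype.piFinset fun _ : V => Finset.Icc 1 x).filter
            fun c => ∀ e ∈ F, c e.1 = c e.2 ∧ c e.1 ≤ y).card : ℚ) := by
  let r : Setoid V := Relation.EqvGen.setoid fun v w => (v, w) ∈ F
  let T : Quotient r → Prop := fun q => ∃ e ∈ F, Quotient.mk r e.1 = q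
  refine ⟨∏ q : Quotient r, if T q then MvPolynomial.X 1 else MvPolynomial.X 0, ?_⟩
  intro x y hy hyx
  have himage : ((Fintype.piFinset fun _ : V => Finset.Icc 1 x).filter
      fun c => ∀ e ∈ F, c e.1 = c e.2 ∧ c e.1 ≤ y)
      = (Fintype.piFinset fun q : Quotient r => Finset.Icc 1 (if T q then y else x)).image
          fun g v => g (Quotient.mk r v) := by
    ext c
    simp only [Finset.mem_filter, Fintype.mem_piFinset, Finset.mem_image, Finset.mem_Icc]
    constructor
    · rintro ⟨hc, hF⟩
      have hlift : ∀ v w, r v w → c v = c w := by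
        intro v w h
        induction h with
        | rel v w h => exact (hF _ h).1
        | refl v => rfl
        | symm v w _ ih => exact ih.symm
        | trans u v w _ _ ih₁ ih₂ => exact ih₁.trans ih₂
      refine ⟨Quotient.lift c hlift, ?_, rfl⟩
      intro q
      split_ifs with hq
      · obtain ⟨e, he, rfl⟩ := hq
        exact ⟨(hc e.1).1, (hF e he).2⟩
      · induction q using Quotient.inductionOn with
        | h v => exact hc v
    · rintro ⟨g, hg, rfl⟩
      refine ⟨fun v => ⟨(hg _).1, (hg _).2.trans ?_⟩, fun e he => ⟨?_, ?_⟩⟩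
      · split_ifs
        · exact hyx
        · exact le_rfl
      · exact congrArg g (Quotient.sound (Relation.EqvGen.rel _ _ he))
      · have h := (hg (Quotient.mk r e.1)).2
        rwa [if_pos ⟨e, he, rfl⟩] at h
  have hinj : Function.Injective fun (g : Quotient r → ℤ) v => g (Quotient.mk r v) := by
    intro g h hgh
    funext q
    induction q using Quotient.inductionOn with
    | h v => exact congrFun hgh v
  rw [himage, Finset.card_image_of_injective _ hinj, Fintype.card_piFinset, map_prod,
    Nat.cast_prod]
  refine Finset.prod_congr rfl fun q _ => ?_
  have hcast : ∀ z : ℤ, 0 ≤ z → (((Finset.Icc 1 z).card : ℕ) : ℚ) = z := by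
    intro z hz
    rw [Int.card_Icc, add_sub_cancel_right, ← Int.cast_natCast, Int.toNat_of_nonneg hz]
  split_ifs
  · simp [hcast y hy, -Int.card_Icc]
  · simp [hcast x (hy.trans hyx), -Int.card_Icc]

open Classical in
/-- The colorings `V → [1, x]` for which both ends of every pair in `F`, and of no pair in `E`,
share a color at most `y` are counted by a polynomial in `x` and `y`. -/
theorem exists_mvPolynomial_card_forced_avoiding {V : Type*} [Fintype V]
    (E F : Finset (V × V)) :
    ∃ p : MvPolynomial (Fin 2) ℚ, ∀ x y : ℤ, 0 ≤ y → y ≤ x →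
      MvPolynomial.eval ![(x : ℚ), (y : ℚ)] p
        = (((Fintype.piFinset fun _ : V => Finset.Icc 1 x).filter
            fun c => (∀ e ∈ F, c e.1 = c e.2 ∧ c e.1 ≤ y) ∧
              ∀ e ∈ E, ¬(c e.1 = c e.2 ∧ c e.1 ≤ y)).card : ℚ) := by
  induction E using Finset.induction_on generalizing F with
  | empty => simpa using exists_mvPolynomial_card_forced F
  | insert a E _ ih =>
    obtain ⟨p, hp⟩ := ih F
    obtain ⟨q, hq⟩ := ih (insert a F)
    refine ⟨p - q, fun x y hy hyx => ?_⟩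
    rw [map_sub, hp x y hy hyx, hq x y hy hyx, sub_eq_iff_eq_add, ← Nat.cast_add, Nat.cast_inj,
      ← Finset.card_filter_add_card_filter_not (fun c : V → ℤ => c a.1 = c a.2 ∧ c a.1 ≤ y),
      add_comm, Finset.filter_filter, Finset.filter_filter]
    congr 2
    · refine Finset.filter_congr fun c _ => ?_
      rw [Finset.forall_mem_insert]
      tauto
    · refine Finset.filter_congr fun c _ => ?_
      rw [Finset.forall_mem_insert]
      tauto

/-- For every finite simple graph `G` there is a polynomial `p ∈ ℚ[X,Y]`
such that `p(x,y) = χ_G(x,y)` for all integers `x ≥ 1` and `0 ≤ y ≤ x`. -/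
theorem stmt_13 (V : Type) [Fintype V] (G : SimpleGraph V) :
    ∃ p : MvPolynomial (Fin 2) ℚ,
      ∀ x y : ℤ, 1 ≤ x → 0 ≤ y → y ≤ x →
        MvPolynomial.eval ![(x : ℚ), (y : ℚ)] p
          = (Nat.card {c : V → ℤ //
              (∀ v, 1 ≤ c v ∧ c v ≤ x) ∧
              (∀ v w : V, G.Adj v w → (c v ≠ c w ∨ (c v = c w ∧ y < c v)))} : ℚ) := by
  classical
  obtain ⟨p, hp⟩ := exists_mvPolynomial_card_forced_avoiding
    (Finset.univ.filter fun e : V × V => G.Adj e.1 e.2) ∅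
  refine ⟨p, fun x y _ hy hyx => ?_⟩
  rw [hp x y hy hyx, Nat.cast_inj]
  symm
  refine Nat.subtype_card _ fun c => ?_
  simp only [Finset.mem_filter, Fintype.mem_piFinset, Finset.mem_Icc, Finset.mem_univ, true_and,
    Finset.notMem_empty, false_imp_iff, implies_true, Prod.forall]
  refine and_congr_right fun _ => forall₃_congr fun v w _ => ?_
  rw [← not_le]
  tauto
end
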